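/- arXiv:2303.16806 — 2 statements merged into one kernel-verified Lean document; each statement's English description precedes it below -/
import Mathlib

section
/- For every 2-player stage game G: G ∉ 𝒢_LS^{m,p} and G ∈ 𝒢_LS^{m,m} if and only if at least one of the following holds: (1) |V₁^{m,p}| = 0, |V₂^{m,p}| = 0, and the mixed-mixed characterization condition holds for G; OR (2) |V₁^{m,p}| = 1, |V₂^{m,p}| = 1, and the mixed-mixed characterization condition holds for G; OR (3) |V₁^{m,p}| > 1, |V₂^{m,p}| = 1, the mixed-pure characterization condition does not hold for G, and the mixed-mixed characterization condition holds for G; OR (4) |V₁^{m,p}| = 1, |V₂^{m,p}| > 1, the mixed-pure characterization condition does not hold for G, and the mixed-mixed characterization condition holds for G. -/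
open Finset

/-- A mixed strategy on a finite action set: a probability distribution. -/
structure Mix (A : Type*) [Fintype A] where
  p : A → ℝ
  nonneg : ∀ a, 0 ≤ p a
  sum_one : ∑ a, p a = 1

namespace Mix

/-- The Dirac (pure) mixed strategy at an action. -/
def pure {A : Type*} [Fintype A] [DecidableEq A] (a : A) : Mix A where
  p := fun b => if b = a then 1 else 0
  nonneg := by intro b; by_cases hb : b = a <;> simp [hb]
  sum_one := by simp

/-- The support of a mixed strategy. -/
def support {A : Type*} [Fintype A] (σ : Mix A) : Set A := {a | 0 < σ.p a}

end Mix

section TwoPlayer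

variable {A₁ A₂ : Type*} [Fintype A₁] [Fintype A₂] [DecidableEq A₁] [DecidableEq A₂]

/-- Expected payoff under a mixed strategy profile. -/
def expPay (u : A₁ → A₂ → ℝ) (σ₁ : Mix A₁) (σ₂ : Mix A₂) : ℝ :=
  ∑ a₁, ∑ a₂, σ₁.p a₁ * σ₂.p a₂ * u a₁ a₂

/-- Player 1's pure action `a₁` is a best response among pure strategies to `a₂`. -/
def BR1p (u₁ : A₁ → A₂ → ℝ) (a₁ : A₁) (a₂ : A₂) : Prop := ∀ b₁, u₁ b₁ a₂ ≤ u₁ a₁ a₂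

/-- Player 2's pure action `a₂` is a best response among pure strategies to `a₁`. -/
def BR2p (u₂ : A₁ → A₂ → ℝ) (a₁ : A₁) (a₂ : A₂) : Prop := ∀ b₂, u₂ a₁ b₂ ≤ u₂ a₁ a₂

/-- Player 1's mixed strategy `σ₁` is a best response (among mixed strategies) to `σ₂`. -/
def BR1m (u₁ : A₁ → A₂ → ℝ) (σ₁ : Mix A₁) (σ₂ : Mix A₂) : Prop :=
  ∀ τ₁ : Mix A₁, expPay u₁ τ₁ σ₂ ≤ expPay u₁ σ₁ σ₂

/-- Player 2's mixed strategy `σ₂` is a best response (among mixed strategies) to `σ₁`. -/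
def BR2m (u₂ : A₁ → A₂ → ℝ) (σ₁ : Mix A₁) (σ₂ : Mix A₂) : Prop :=
  ∀ τ₂ : Mix A₂, expPay u₂ σ₁ τ₂ ≤ expPay u₂ σ₁ σ₂

/-- Player 2's pure action `a₂` is a best response among pure strategies to mixed `σ₁`. -/
def BR2pm (u₂ : A₁ → A₂ → ℝ) (σ₁ : Mix A₁) (a₂ : A₂) : Prop :=
  ∀ b₂ : A₂, expPay u₂ σ₁ (Mix.pure b₂) ≤ expPay u₂ σ₁ (Mix.pure a₂)

/-- Pure Nash equilibria (both players restricted to pure strategies). -/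
def NashPP (u₁ u₂ : A₁ → A₂ → ℝ) : Set (A₁ × A₂) :=
  {q | BR1p u₁ q.1 q.2 ∧ BR2p u₂ q.1 q.2}

/-- Nash equilibria when player 1 is mixed and player 2 is pure. -/
def NashMP (u₁ u₂ : A₁ → A₂ → ℝ) : Set (Mix A₁ × A₂) :=
  {q | BR1m u₁ q.1 (Mix.pure q.2) ∧ BR2pm u₂ q.1 q.2}

/-- Mixed Nash equilibria. -/
def NashMM (u₁ u₂ : A₁ → A₂ → ℝ) : Set (Mix A₁ × Mix A₂) :=
  {q | BR1m u₁ q.1 q.2 ∧ BR2m u₂ q.1 q.2}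

def V1pp (u₁ u₂ : A₁ → A₂ → ℝ) : Set ℝ := (fun q => u₁ q.1 q.2) '' NashPP u₁ u₂
def V2pp (u₁ u₂ : A₁ → A₂ → ℝ) : Set ℝ := (fun q => u₂ q.1 q.2) '' NashPP u₁ u₂
def V1mp (u₁ u₂ : A₁ → A₂ → ℝ) : Set ℝ :=
  (fun q => expPay u₁ q.1 (Mix.pure q.2)) '' NashMP u₁ u₂
def V2mp (u₁ u₂ : A₁ → A₂ → ℝ) : Set ℝ :=
  (fun q => expPay u₂ q.1 (Mix.pure q.2)) '' NashMP u₁ u₂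
def V1mm (u₁ u₂ : A₁ → A₂ → ℝ) : Set ℝ := (fun q => expPay u₁ q.1 q.2) '' NashMM u₁ u₂
def V2mm (u₁ u₂ : A₁ → A₂ → ℝ) : Set ℝ := (fun q => expPay u₂ q.1 q.2) '' NashMM u₁ u₂

/-- The set `V` is a singleton, i.e. `|V| = 1`. -/
def oneVal (V : Set ℝ) : Prop := ∃ v, V = {v}

/-- A history of play: a finite sequence of pure action profiles. -/
abbrev Hist (A₁ A₂ : Type*) := List (A₁ × A₂)

/-- A pure behavior strategy for player 1, seen as a mixed behavior strategy. -/
def pureBeh1 (μ : Hist A₁ A₂ → A₁) : Hist A₁ A₂ → Mix A₁ := fun h => Mix.pure (μ h)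

/-- A pure behavior strategy for player 2, seen as a mixed behavior strategy. -/
def pureBeh2 (μ : Hist A₁ A₂ → A₂) : Hist A₁ A₂ → Mix A₂ := fun h => Mix.pure (μ h)

/-- Expected total payoff (w.r.t. `u`) over `T` remaining rounds, after history `h`. -/
def totPay (u : A₁ → A₂ → ℝ) (μ₁ : Hist A₁ A₂ → Mix A₁) (μ₂ : Hist A₁ A₂ → Mix A₂) :
    ℕ → Hist A₁ A₂ → ℝ
  | 0, _ => 0
  | T + 1, h =>
      ∑ a₁, ∑ a₂, (μ₁ h).p a₁ * (μ₂ h).p a₂ * (u a₁ a₂ + totPay u μ₁ μ₂ T (h ++ [(a₁, a₂)]))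

/-- The behavior strategy induced on the subgame following history `h`. -/
def condS {A₁ A₂ α : Type*} (μ : Hist A₁ A₂ → α) (h : Hist A₁ A₂) : Hist A₁ A₂ → α :=
  fun h' => μ (h ++ h')

/-- Nash equilibrium of the `T`-round repeated game, both players mixed. -/
def isNEmm (u₁ u₂ : A₁ → A₂ → ℝ) (T : ℕ)
    (μ₁ : Hist A₁ A₂ → Mix A₁) (μ₂ : Hist A₁ A₂ → Mix A₂) : Prop :=
  (∀ μ₁' : Hist A₁ A₂ → Mix A₁, totPay u₁ μ₁' μ₂ T [] ≤ totPay u₁ μ₁ μ₂ T []) ∧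
  (∀ μ₂' : Hist A₁ A₂ → Mix A₂, totPay u₂ μ₁ μ₂' T [] ≤ totPay u₂ μ₁ μ₂ T [])

/-- Subgame-perfect equilibrium of the `T`-round repeated game, both players mixed. -/
def isSPEmm (u₁ u₂ : A₁ → A₂ → ℝ) (T : ℕ)
    (μ₁ : Hist A₁ A₂ → Mix A₁) (μ₂ : Hist A₁ A₂ → Mix A₂) : Prop :=
  ∀ h : Hist A₁ A₂, h.length < T → isNEmm u₁ u₂ (T - h.length) (condS μ₁ h) (condS μ₂ h)

/-- Nash equilibrium of the `T`-round repeated game, player 1 mixed and player 2 pure. -/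
def isNEmp (u₁ u₂ : A₁ → A₂ → ℝ) (T : ℕ)
    (μ₁ : Hist A₁ A₂ → Mix A₁) (μ₂ : Hist A₁ A₂ → A₂) : Prop :=
  (∀ μ₁' : Hist A₁ A₂ → Mix A₁,
      totPay u₁ μ₁' (pureBeh2 μ₂) T [] ≤ totPay u₁ μ₁ (pureBeh2 μ₂) T []) ∧
  (∀ μ₂' : Hist A₁ A₂ → A₂,
      totPay u₂ μ₁ (pureBeh2 μ₂') T [] ≤ totPay u₂ μ₁ (pureBeh2 μ₂) T [])

/-- SPE of the `T`-round repeated game, player 1 mixed and player 2 pure. -/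
def isSPEmp (u₁ u₂ : A₁ → A₂ → ℝ) (T : ℕ)
    (μ₁ : Hist A₁ A₂ → Mix A₁) (μ₂ : Hist A₁ A₂ → A₂) : Prop :=
  ∀ h : Hist A₁ A₂, h.length < T → isNEmp u₁ u₂ (T - h.length) (condS μ₁ h) (condS μ₂ h)

/-- Nash equilibrium of the `T`-round repeated game, both players pure. -/
def isNEpp (u₁ u₂ : A₁ → A₂ → ℝ) (T : ℕ)
    (μ₁ : Hist A₁ A₂ → A₁) (μ₂ : Hist A₁ A₂ → A₂) : Prop :=
  (∀ μ₁' : Hist A₁ A₂ → A₁,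
      totPay u₁ (pureBeh1 μ₁') (pureBeh2 μ₂) T [] ≤
        totPay u₁ (pureBeh1 μ₁) (pureBeh2 μ₂) T []) ∧
  (∀ μ₂' : Hist A₁ A₂ → A₂,
      totPay u₂ (pureBeh1 μ₁) (pureBeh2 μ₂') T [] ≤
        totPay u₂ (pureBeh1 μ₁) (pureBeh2 μ₂) T [])

/-- SPE of the `T`-round repeated game, both players pure. -/
def isSPEpp (u₁ u₂ : A₁ → A₂ → ℝ) (T : ℕ)
    (μ₁ : Hist A₁ A₂ → A₁) (μ₂ : Hist A₁ A₂ → A₂) : Prop :=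
  ∀ h : Hist A₁ A₂, h.length < T → isNEpp u₁ u₂ (T - h.length) (condS μ₁ h) (condS μ₂ h)

/-- `G ∈ 𝒢_LS^{p,p}`: local suboptimality occurs in some SPE of some `G(T)`,
both players restricted to pure strategies. -/
def GLSpp (u₁ u₂ : A₁ → A₂ → ℝ) : Prop :=
  ∃ T : ℕ, 1 ≤ T ∧ ∃ (μ₁ : Hist A₁ A₂ → A₁) (μ₂ : Hist A₁ A₂ → A₂),
    isSPEpp u₁ u₂ T μ₁ μ₂ ∧ ∃ h : Hist A₁ A₂, h.length < T ∧ (μ₁ h, μ₂ h) ∉ NashPP u₁ u₂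

/-- `G ∈ 𝒢_LS^{m,p}`: local suboptimality occurs in some SPE of some `G(T)`,
player 1 mixed and player 2 pure. -/
def GLSmp (u₁ u₂ : A₁ → A₂ → ℝ) : Prop :=
  ∃ T : ℕ, 1 ≤ T ∧ ∃ (μ₁ : Hist A₁ A₂ → Mix A₁) (μ₂ : Hist A₁ A₂ → A₂),
    isSPEmp u₁ u₂ T μ₁ μ₂ ∧ ∃ h : Hist A₁ A₂, h.length < T ∧ (μ₁ h, μ₂ h) ∉ NashMP u₁ u₂

/-- `G ∈ 𝒢_LS^{m,m}`: local suboptimality occurs in some SPE of some `G(T)`,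
both players mixed. -/
def GLSmm (u₁ u₂ : A₁ → A₂ → ℝ) : Prop :=
  ∃ T : ℕ, 1 ≤ T ∧ ∃ (μ₁ : Hist A₁ A₂ → Mix A₁) (μ₂ : Hist A₁ A₂ → Mix A₂),
    isSPEmm u₁ u₂ T μ₁ μ₂ ∧ ∃ h : Hist A₁ A₂, h.length < T ∧ (μ₁ h, μ₂ h) ∉ NashMM u₁ u₂

/-- The pure-pure characterization condition (condition of the pure-strategy theorem). -/
def condPP (u₁ u₂ : A₁ → A₂ → ℝ) : Prop :=
  ((V1pp u₁ u₂).Nontrivial ∧ (V2pp u₁ u₂).Nontrivial ∧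
    ∃ (a₁ : A₁) (a₂ : A₂), (a₁, a₂) ∉ NashPP u₁ u₂) ∨
  ((V1pp u₁ u₂).Nontrivial ∧ oneVal (V2pp u₁ u₂) ∧
    ∃ (a₁ a₁' : A₁) (a₂ : A₂), u₁ a₁ a₂ < u₁ a₁' a₂ ∧ BR2p u₂ a₁ a₂) ∨
  (oneVal (V1pp u₁ u₂) ∧ (V2pp u₁ u₂).Nontrivial ∧
    ∃ (a₁ : A₁) (a₂ a₂' : A₂), u₂ a₁ a₂ < u₂ a₁ a₂' ∧ BR1p u₁ a₁ a₂)

/-- The mixed-mixed characterization condition (condition of the general-case theorem). -/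
def condMM (u₁ u₂ : A₁ → A₂ → ℝ) : Prop :=
  ((V1mm u₁ u₂).Nontrivial ∧ (V2mm u₁ u₂).Nontrivial ∧
    ∃ (σ₁ : Mix A₁) (σ₂ : Mix A₂), (σ₁, σ₂) ∉ NashMM u₁ u₂) ∨
  ((V1mm u₁ u₂).Nontrivial ∧ oneVal (V2mm u₁ u₂) ∧
    ∃ (σ₁ : Mix A₁) (σ₂ : Mix A₂) (a₁' : A₁),
      expPay u₁ σ₁ σ₂ < expPay u₁ (Mix.pure a₁') σ₂ ∧ BR2m u₂ σ₁ σ₂) ∨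
  (oneVal (V1mm u₁ u₂) ∧ (V2mm u₁ u₂).Nontrivial ∧
    ∃ (σ₁ : Mix A₁) (σ₂ : Mix A₂) (a₂' : A₂),
      expPay u₂ σ₁ σ₂ < expPay u₂ σ₁ (Mix.pure a₂') ∧ BR1m u₁ σ₁ σ₂)

/-- The set `D` of differences of player 1's payoffs between pairs of stage-game
Nash equilibria (mixed-pure case). -/
def Dmp (u₁ u₂ : A₁ → A₂ → ℝ) : Set ℝ :=
  {x | ∃ q ∈ NashMP u₁ u₂, ∃ q' ∈ NashMP u₁ u₂,
    x = expPay u₁ q.1 (Mix.pure q.2) - expPay u₁ q'.1 (Mix.pure q'.2)}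

/-- `x` is a finite (possibly empty) sum of elements of `D`. -/
def sumOfD (D : Set ℝ) (x : ℝ) : Prop :=
  ∃ (n : ℕ) (d : Fin n → ℝ), (∀ k, d k ∈ D) ∧ x = ∑ k, d k

/-- The mixed-pure characterization condition (condition of the
pure-strategy-against-mixed-strategy theorem). -/
def condMP (u₁ u₂ : A₁ → A₂ → ℝ) : Prop :=
  ((V1mp u₁ u₂).Nontrivial ∧ (V2mp u₁ u₂).Nontrivial ∧
    ∃ (σ₁ : Mix A₁) (a₂ : A₂), (σ₁, a₂) ∉ NashMP u₁ u₂) ∨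
  ((V1mp u₁ u₂).Nontrivial ∧ oneVal (V2mp u₁ u₂) ∧
    ∃ (σ₁ : Mix A₁) (a₁' : A₁) (a₂ : A₂),
      expPay u₁ σ₁ (Mix.pure a₂) < u₁ a₁' a₂ ∧
      BR2pm u₂ σ₁ a₂ ∧
      (σ₁.support.Nontrivial →
        ∃ a ∈ σ₁.support, ∀ a' ∈ σ₁.support, a' ≠ a →
          sumOfD (Dmp u₁ u₂) (u₁ a a₂ - u₁ a' a₂))) ∨
  (oneVal (V1mp u₁ u₂) ∧ (V2mp u₁ u₂).Nontrivial ∧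
    ∃ (σ₁ : Mix A₁) (a₂ a₂' : A₂),
      expPay u₂ σ₁ (Mix.pure a₂) < expPay u₂ σ₁ (Mix.pure a₂') ∧
      BR1m u₁ σ₁ (Mix.pure a₂))

/-- A history is reachable under the behavior profile `(μ₁, μ₂)` (mixed-pure case):
every action of player 1 along it has positive probability and every action of
player 2 along it is the prescribed one. -/
def reachableMP (μ₁ : Hist A₁ A₂ → Mix A₁) (μ₂ : Hist A₁ A₂ → A₂) (h : Hist A₁ A₂) : Prop :=
  ∀ k : Fin h.length, 0 < (μ₁ (h.take k.val)).p (h.get k).1 ∧ μ₂ (h.take k.val) = (h.get k).2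

end TwoPlayer

namespace Mix

variable {A : Type*} [Fintype A]

/-- The convex combination `(1 - θ) σ + θ τ` of two mixed strategies. -/
def lineMap (θ : ℝ) (hθ : θ ∈ Set.Icc (0 : ℝ) 1) (σ τ : Mix A) : Mix A where
  p := fun a => (1 - θ) * σ.p a + θ * τ.p a
  nonneg := fun a => add_nonneg (mul_nonneg (sub_nonneg.2 hθ.2) (σ.nonneg a))
    (mul_nonneg hθ.1 (τ.nonneg a))
  sum_one := by
    rw [Finset.sum_add_distrib, ← Finset.mul_sum, ← Finset.mul_sum, σ.sum_one, τ.sum_one]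
    ring

theorem exists_pos (σ : Mix A) : ∃ a, 0 < σ.p a := by
  by_contra! h
  have := Finset.sum_nonpos (s := Finset.univ) fun a _ => h a
  rw [σ.sum_one] at this
  linarith

theorem pure_pos_iff [DecidableEq A] {a b : A} : 0 < (Mix.pure a).p b ↔ b = a := by
  by_cases h : b = a <;> simp [Mix.pure, h]

/-- A weighted average of values bounded by `m` attains `m` only if every value of positive weight
is `m`. -/
theorem eq_of_le_of_sum_eq (σ : Mix A) {f : A → ℝ} {m : ℝ} (hf : ∀ a, 0 < σ.p a → f a ≤ m)
    (hm : ∑ a, σ.p a * f a = m) {a : A} (ha : 0 < σ.p a) : f a = m := by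
  have h0 : ∑ a, σ.p a * (m - f a) = 0 := by
    simp_rw [mul_sub]
    rw [Finset.sum_sub_distrib, ← Finset.sum_mul, σ.sum_one, hm]
    ring
  have hnn : ∀ a ∈ Finset.univ, 0 ≤ σ.p a * (m - f a) := fun a _ => by
    rcases (σ.nonneg a).eq_or_lt with h | h
    · simp [← h]
    · exact mul_nonneg h.le (sub_nonneg.2 (hf a h))
  have := (Finset.sum_eq_zero_iff_of_nonneg hnn).1 h0 a (Finset.mem_univ a)
  rcases mul_eq_zero.1 this with h | h <;> linarith

theorem sum_mul_le (σ : Mix A) {f : A → ℝ} {m : ℝ} (hf : ∀ a, f a ≤ m) :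
    ∑ a, σ.p a * f a ≤ m := by
  calc ∑ a, σ.p a * f a ≤ ∑ a, σ.p a * m :=
        Finset.sum_le_sum fun a _ => mul_le_mul_of_nonneg_left (hf a) (σ.nonneg a)
    _ = m := by rw [← Finset.sum_mul, σ.sum_one, one_mul]

theorem sum_mul_eq (σ : Mix A) {f : A → ℝ} {m : ℝ} (hf : ∀ a, 0 < σ.p a → f a = m) :
    ∑ a, σ.p a * f a = m := by
  calc ∑ a, σ.p a * f a = ∑ a, σ.p a * m := by
        refine Finset.sum_congr rfl fun a _ => ?_
        rcases (σ.nonneg a).eq_or_lt with h | h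
        · simp [← h]
        · rw [hf a h]
    _ = m := by rw [← Finset.sum_mul, σ.sum_one, one_mul]

end Mix

section StageGame

variable {A₁ A₂ : Type*} [Fintype A₁] [Fintype A₂]

theorem expPay_flip (u : A₁ → A₂ → ℝ) (σ₁ : Mix A₁) (σ₂ : Mix A₂) :
    expPay (fun b a => u a b) σ₂ σ₁ = expPay u σ₁ σ₂ := by
  unfold expPay
  rw [Finset.sum_comm]
  simp_rw [mul_comm (σ₂.p _)]

theorem expPay_add (u w : A₁ → A₂ → ℝ) (σ₁ : Mix A₁) (σ₂ : Mix A₂) :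
    expPay (fun a b => u a b + w a b) σ₁ σ₂ = expPay u σ₁ σ₂ + expPay w σ₁ σ₂ := by
  simp only [expPay, mul_add, Finset.sum_add_distrib]

theorem expPay_of_left (c : A₁ → ℝ) (σ₁ : Mix A₁) (σ₂ : Mix A₂) :
    expPay (fun a _ => c a) σ₁ σ₂ = ∑ a, σ₁.p a * c a := by
  unfold expPay
  refine Finset.sum_congr rfl fun a _ => ?_
  rw [← Finset.sum_mul, ← Finset.mul_sum, σ₂.sum_one, mul_one]

theorem expPay_const (c : ℝ) (σ₁ : Mix A₁) (σ₂ : Mix A₂) :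
    expPay (fun _ _ => c) σ₁ σ₂ = c := by
  rw [expPay_of_left (fun _ => c), ← Finset.sum_mul, σ₁.sum_one, one_mul]

theorem expPay_mono {u w : A₁ → A₂ → ℝ} (h : ∀ a b, u a b ≤ w a b) (σ₁ : Mix A₁) (σ₂ : Mix A₂) :
    expPay u σ₁ σ₂ ≤ expPay w σ₁ σ₂ :=
  Finset.sum_le_sum fun a _ => Finset.sum_le_sum fun b _ =>
    mul_le_mul_of_nonneg_left (h a b) (mul_nonneg (σ₁.nonneg a) (σ₂.nonneg b))

theorem expPay_lineMap_left (u : A₁ → A₂ → ℝ) {θ : ℝ} (hθ : θ ∈ Set.Icc (0 : ℝ) 1)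
    (σ₁ τ₁ : Mix A₁) (σ₂ : Mix A₂) :
    expPay u (Mix.lineMap θ hθ σ₁ τ₁) σ₂ = (1 - θ) * expPay u σ₁ σ₂ + θ * expPay u τ₁ σ₂ := by
  simp only [expPay, Mix.lineMap, Finset.mul_sum, ← Finset.sum_add_distrib]
  refine Finset.sum_congr rfl fun a _ => Finset.sum_congr rfl fun b _ => ?_
  ring

theorem expPay_lineMap_right (u : A₁ → A₂ → ℝ) {θ : ℝ} (hθ : θ ∈ Set.Icc (0 : ℝ) 1)
    (σ₁ : Mix A₁) (σ₂ τ₂ : Mix A₂) :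
    expPay u σ₁ (Mix.lineMap θ hθ σ₂ τ₂) = (1 - θ) * expPay u σ₁ σ₂ + θ * expPay u σ₁ τ₂ := by
  simp only [← expPay_flip u, expPay_lineMap_left]

theorem BR1m_flip {u : A₁ → A₂ → ℝ} {σ₁ : Mix A₁} {σ₂ : Mix A₂} :
    BR1m (fun b a => u a b) σ₂ σ₁ ↔ BR2m u σ₁ σ₂ := by
  simp only [BR1m, BR2m, expPay_flip]

theorem BR2m_flip {u : A₁ → A₂ → ℝ} {σ₁ : Mix A₁} {σ₂ : Mix A₂} :
    BR2m (fun b a => u a b) σ₂ σ₁ ↔ BR1m u σ₁ σ₂ := by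
  simp only [BR1m, BR2m, expPay_flip]

theorem BR1m_add_const {u : A₁ → A₂ → ℝ} {c : ℝ} {σ₁ : Mix A₁} {σ₂ : Mix A₂} :
    BR1m (fun a b => u a b + c) σ₁ σ₂ ↔ BR1m u σ₁ σ₂ := by
  simp [BR1m, expPay_add, expPay_const]

theorem BR2m_add_const {u : A₁ → A₂ → ℝ} {c : ℝ} {σ₁ : Mix A₁} {σ₂ : Mix A₂} :
    BR2m (fun a b => u a b + c) σ₁ σ₂ ↔ BR2m u σ₁ σ₂ := by
  simp [BR2m, expPay_add, expPay_const]

theorem BR2m.lineMap {u : A₁ → A₂ → ℝ} {θ : ℝ} (hθ : θ ∈ Set.Icc (0 : ℝ) 1) {σ₁ : Mix A₁}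
    {σ₂ τ₂ : Mix A₂} (hσ : BR2m u σ₁ σ₂) (hτ : BR2m u σ₁ τ₂) :
    BR2m u σ₁ (Mix.lineMap θ hθ σ₂ τ₂) := fun ρ => by
  rw [expPay_lineMap_right, le_antisymm (hτ σ₂) (hσ τ₂)]
  linarith [hτ ρ]

/-- Mixed Nash equilibria with strategies in prescribed classes. -/
def NashIn (P₁ : Set (Mix A₁)) (P₂ : Set (Mix A₂)) (u₁ u₂ : A₁ → A₂ → ℝ) :
    Set (Mix A₁ × Mix A₂) :=
  {q | q ∈ NashMM u₁ u₂ ∧ q.1 ∈ P₁ ∧ q.2 ∈ P₂}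

theorem NashIn_univ (u₁ u₂ : A₁ → A₂ → ℝ) :
    NashIn Set.univ Set.univ u₁ u₂ = NashMM u₁ u₂ := by
  simp [NashIn]

theorem expPay_pure_left [DecidableEq A₁] (u : A₁ → A₂ → ℝ) (a : A₁) (σ₂ : Mix A₂) :
    expPay u (Mix.pure a) σ₂ = ∑ b, σ₂.p b * u a b := by
  simp [expPay, Mix.pure]

theorem expPay_pure_right [DecidableEq A₂] (u : A₁ → A₂ → ℝ) (σ₁ : Mix A₁) (b : A₂) :
    expPay u σ₁ (Mix.pure b) = ∑ a, σ₁.p a * u a b := by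
  simp [expPay, Mix.pure]

theorem expPay_eq_sum_left [DecidableEq A₁] (u : A₁ → A₂ → ℝ) (σ₁ : Mix A₁) (σ₂ : Mix A₂) :
    expPay u σ₁ σ₂ = ∑ a, σ₁.p a * expPay u (Mix.pure a) σ₂ := by
  simp only [expPay_pure_left, Finset.mul_sum]
  simp only [expPay, mul_assoc]

theorem BR1m_iff [DecidableEq A₁] {u : A₁ → A₂ → ℝ} {σ₁ : Mix A₁} {σ₂ : Mix A₂} :
    BR1m u σ₁ σ₂ ↔ ∀ a, expPay u (Mix.pure a) σ₂ ≤ expPay u σ₁ σ₂ :=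
  ⟨fun h a => h _, fun h τ => by
    rw [expPay_eq_sum_left u τ]
    exact τ.sum_mul_le h⟩

theorem BR2m_iff [DecidableEq A₂] {u : A₁ → A₂ → ℝ} {σ₁ : Mix A₁} {σ₂ : Mix A₂} :
    BR2m u σ₁ σ₂ ↔ ∀ b, expPay u σ₁ (Mix.pure b) ≤ expPay u σ₁ σ₂ := by
  rw [← BR1m_flip, BR1m_iff]
  simp only [expPay_flip]

theorem BR2pm_iff [DecidableEq A₂] {u : A₁ → A₂ → ℝ} {σ₁ : Mix A₁} {b : A₂} :
    BR2pm u σ₁ b ↔ BR2m u σ₁ (Mix.pure b) :=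
  BR2m_iff.symm

theorem BR1m.eq_of_pos [DecidableEq A₁] {u : A₁ → A₂ → ℝ} {σ₁ : Mix A₁} {σ₂ : Mix A₂}
    (h : BR1m u σ₁ σ₂) {a : A₁} (ha : 0 < σ₁.p a) : expPay u (Mix.pure a) σ₂ = expPay u σ₁ σ₂ :=
  σ₁.eq_of_le_of_sum_eq (fun a _ => h (Mix.pure a)) (expPay_eq_sum_left u σ₁ σ₂).symm ha

theorem BR1m_of_pos [DecidableEq A₁] {u : A₁ → A₂ → ℝ} {σ₁ : Mix A₁} {σ₂ : Mix A₂}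
    (h : ∀ a, 0 < σ₁.p a → ∀ a', expPay u (Mix.pure a') σ₂ ≤ expPay u (Mix.pure a) σ₂) :
    BR1m u σ₁ σ₂ := by
  obtain ⟨a, ha⟩ := σ₁.exists_pos
  have := σ₁.sum_mul_eq (f := fun a => expPay u (Mix.pure a) σ₂)
    fun a' ha' => le_antisymm (h a ha a') (h a' ha' a)
  rw [BR1m_iff, expPay_eq_sum_left, this]
  exact h a ha

theorem exists_BR2m_pure [DecidableEq A₂] [Nonempty A₂] (u : A₁ → A₂ → ℝ) (σ₁ : Mix A₁) :
    ∃ b, BR2m u σ₁ (Mix.pure b) := by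
  obtain ⟨b, hb⟩ := Finite.exists_max fun b => expPay u σ₁ (Mix.pure b)
  exact ⟨b, BR2m_iff.2 hb⟩

theorem mem_NashMP_iff [DecidableEq A₂] {u₁ u₂ : A₁ → A₂ → ℝ} {σ₁ : Mix A₁} {b : A₂} :
    (σ₁, b) ∈ NashMP u₁ u₂ ↔ (σ₁, Mix.pure b) ∈ NashMM u₁ u₂ :=
  and_congr Iff.rfl BR2pm_iff

theorem image_NashMP [DecidableEq A₂] (u u₁ u₂ : A₁ → A₂ → ℝ) :
    (fun q : Mix A₁ × A₂ => expPay u q.1 (Mix.pure q.2)) '' NashMP u₁ u₂ =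
      (fun q : Mix A₁ × Mix A₂ => expPay u q.1 q.2) ''
        NashIn Set.univ (Set.range Mix.pure) u₁ u₂ := by
  ext x
  constructor
  · rintro ⟨⟨σ, b⟩, hq, rfl⟩
    exact ⟨(σ, Mix.pure b), ⟨mem_NashMP_iff.1 hq, trivial, b, rfl⟩, rfl⟩
  · rintro ⟨⟨σ, _⟩, ⟨hq, -, b, rfl⟩, rfl⟩
    exact ⟨(σ, b), mem_NashMP_iff.2 hq, rfl⟩

variable [DecidableEq A₁] [DecidableEq A₂]

@[simp]
theorem expPay_pure_pure (u : A₁ → A₂ → ℝ) (a : A₁) (b : A₂) :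
    expPay u (Mix.pure a) (Mix.pure b) = u a b := by
  simp [expPay, Mix.pure]

theorem forall_mem_NashMM_of_pure {u₁ u₂ : A₁ → A₂ → ℝ}
    (h : ∀ a b, (Mix.pure a, Mix.pure b) ∈ NashMM u₁ u₂) (σ₁ : Mix A₁) (σ₂ : Mix A₂) :
    (σ₁, σ₂) ∈ NashMM u₁ u₂ := by
  constructor
  · refine BR1m_of_pos fun a _ a' => ?_
    rw [expPay_pure_left, expPay_pure_left]
    refine Finset.sum_le_sum fun b _ => mul_le_mul_of_nonneg_left ?_ (σ₂.nonneg b)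
    simpa using (h a b).1 (Mix.pure a')
  · refine BR1m_flip.1 (BR1m_of_pos fun b _ b' => ?_)
    rw [expPay_flip u₂, expPay_flip u₂, expPay_pure_right, expPay_pure_right]
    refine Finset.sum_le_sum fun a _ => mul_le_mul_of_nonneg_left ?_ (σ₁.nonneg a)
    simpa using (h a b).2 (Mix.pure b')

end StageGame

theorem condS_drop {A₁ A₂ α : Type*} (ν : Hist A₁ A₂ → α) (h : Hist A₁ A₂) :
    condS (fun l => ν (l.drop h.length)) h = ν := by
  funext l
  simp [condS]

section RepeatedGame

variable {A₁ A₂ : Type*} [Fintype A₁] [Fintype A₂]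

/-- The payoff of the current round after history `h`, augmented by the continuation payoff of the
`n` rounds that follow. -/
def augPay (u : A₁ → A₂ → ℝ) (μ₁ : Hist A₁ A₂ → Mix A₁) (μ₂ : Hist A₁ A₂ → Mix A₂) (n : ℕ)
    (h : Hist A₁ A₂) : A₁ → A₂ → ℝ :=
  fun a b => u a b + totPay u μ₁ μ₂ n (h ++ [(a, b)])

theorem totPay_succ (u : A₁ → A₂ → ℝ) (μ₁ : Hist A₁ A₂ → Mix A₁) (μ₂ : Hist A₁ A₂ → Mix A₂)
    (n : ℕ) (h : Hist A₁ A₂) :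
    totPay u μ₁ μ₂ (n + 1) h = expPay (augPay u μ₁ μ₂ n h) (μ₁ h) (μ₂ h) :=
  rfl

theorem totPay_condS (u : A₁ → A₂ → ℝ) (μ₁ : Hist A₁ A₂ → Mix A₁) (μ₂ : Hist A₁ A₂ → Mix A₂)
    (h : Hist A₁ A₂) (n : ℕ) (l : Hist A₁ A₂) :
    totPay u (condS μ₁ h) (condS μ₂ h) n l = totPay u μ₁ μ₂ n (h ++ l) := by
  induction n generalizing l with
  | zero => rfl
  | succ n ih => simp [totPay, ih, condS]

theorem totPay_congr (u : A₁ → A₂ → ℝ) {μ₁ ν₁ : Hist A₁ A₂ → Mix A₁}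
    {μ₂ ν₂ : Hist A₁ A₂ → Mix A₂} (n : ℕ) {h : Hist A₁ A₂}
    (h₁ : ∀ l, μ₁ (h ++ l) = ν₁ (h ++ l)) (h₂ : ∀ l, μ₂ (h ++ l) = ν₂ (h ++ l)) :
    totPay u μ₁ μ₂ n h = totPay u ν₁ ν₂ n h := by
  induction n generalizing h with
  | zero => rfl
  | succ n ih =>
    have e₁ := h₁ []
    have e₂ := h₂ []
    rw [List.append_nil] at e₁ e₂
    simp only [totPay, e₁, e₂]
    refine Finset.sum_congr rfl fun a _ => Finset.sum_congr rfl fun b _ => ?_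
    rw [ih (fun l => by simpa using h₁ ((a, b) :: l)) (fun l => by simpa using h₂ ((a, b) :: l))]

theorem totPay_eq_mul {u : A₁ → A₂ → ℝ} {μ₁ : Hist A₁ A₂ → Mix A₁} {μ₂ : Hist A₁ A₂ → Mix A₂}
    {T : ℕ} {v : ℝ} {k : ℕ}
    (hv : ∀ h, k ≤ h.length → h.length < T → expPay u (μ₁ h) (μ₂ h) = v) (n : ℕ)
    (h : Hist A₁ A₂) (hk : k ≤ h.length) (hn : h.length + n = T) :
    totPay u μ₁ μ₂ n h = n * v := by
  induction n generalizing h with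
  | zero => simp [totPay]
  | succ n ih =>
    have : augPay u μ₁ μ₂ n h = fun a b => u a b + n * v := by
      funext a b
      rw [augPay, ih _ (by simp; omega) (by simp; omega)]
    rw [totPay_succ, this, expPay_add, expPay_const, hv h hk (by omega)]
    push_cast
    ring

/-- The one-shot form of subgame perfection: after every history the prescribed profile is an
equilibrium of the stage game augmented by continuation payoffs. -/
def OneShot (u₁ u₂ : A₁ → A₂ → ℝ) (T : ℕ) (μ₁ : Hist A₁ A₂ → Mix A₁)
    (μ₂ : Hist A₁ A₂ → Mix A₂) : Prop :=
  ∀ h n, h.length + (n + 1) = T →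
    BR1m (augPay u₁ μ₁ μ₂ n h) (μ₁ h) (μ₂ h) ∧ BR2m (augPay u₂ μ₁ μ₂ n h) (μ₁ h) (μ₂ h)

theorem OneShot.totPay_le_left {u₁ u₂ : A₁ → A₂ → ℝ} {T : ℕ} {μ₁ : Hist A₁ A₂ → Mix A₁}
    {μ₂ : Hist A₁ A₂ → Mix A₂} (H : OneShot u₁ u₂ T μ₁ μ₂) (ν₁ : Hist A₁ A₂ → Mix A₁) (n : ℕ)
    (h : Hist A₁ A₂) (hn : h.length + n = T) :
    totPay u₁ ν₁ μ₂ n h ≤ totPay u₁ μ₁ μ₂ n h := by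
  induction n generalizing h with
  | zero => exact le_rfl
  | succ n ih =>
    exact (expPay_mono (fun a b => add_le_add le_rfl (ih _ (by simp; omega))) _ _).trans
      ((H h n hn).1 _)

theorem OneShot.totPay_le_right {u₁ u₂ : A₁ → A₂ → ℝ} {T : ℕ} {μ₁ : Hist A₁ A₂ → Mix A₁}
    {μ₂ : Hist A₁ A₂ → Mix A₂} (H : OneShot u₁ u₂ T μ₁ μ₂) (ν₂ : Hist A₁ A₂ → Mix A₂) (n : ℕ)
    (h : Hist A₁ A₂) (hn : h.length + n = T) :
    totPay u₂ μ₁ ν₂ n h ≤ totPay u₂ μ₁ μ₂ n h := by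
  induction n generalizing h with
  | zero => exact le_rfl
  | succ n ih =>
    exact (expPay_mono (fun a b => add_le_add le_rfl (ih _ (by simp; omega))) _ _).trans
      ((H h n hn).2 _)

theorem OneShot.isSPEmm {u₁ u₂ : A₁ → A₂ → ℝ} {T : ℕ} {μ₁ : Hist A₁ A₂ → Mix A₁}
    {μ₂ : Hist A₁ A₂ → Mix A₂} (H : OneShot u₁ u₂ T μ₁ μ₂) : isSPEmm u₁ u₂ T μ₁ μ₂ := by
  intro h hT
  constructor
  · intro ν
    rw [← condS_drop ν h, totPay_condS, totPay_condS]
    exact H.totPay_le_left _ _ _ (by simp; omega)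
  · intro ν
    rw [← condS_drop ν h, totPay_condS, totPay_condS]
    exact H.totPay_le_right _ _ _ (by simp; omega)

/-- A locally suboptimal profile remains so at some history after which play is a stage equilibrium
forever. -/
theorem exists_last_suboptimal {u₁ u₂ : A₁ → A₂ → ℝ} {T : ℕ} {μ₁ : Hist A₁ A₂ → Mix A₁}
    {μ₂ : Hist A₁ A₂ → Mix A₂} (h : Hist A₁ A₂) (hT : h.length < T)
    (hh : (μ₁ h, μ₂ h) ∉ NashMM u₁ u₂) :
    ∃ (h : Hist A₁ A₂) (n : ℕ), h.length + (n + 1) = T ∧ (μ₁ h, μ₂ h) ∉ NashMM u₁ u₂ ∧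
      ∀ l : Hist A₁ A₂, h.length < l.length → l.length < T → (μ₁ l, μ₂ l) ∈ NashMM u₁ u₂ := by
  induction hm : T - h.length using Nat.strong_induction_on generalizing h with
  | _ m ih =>
    by_cases H : ∀ l : Hist A₁ A₂, h.length < l.length → l.length < T →
        (μ₁ l, μ₂ l) ∈ NashMM u₁ u₂
    · exact ⟨h, T - h.length - 1, by omega, hh, H⟩
    · push Not at H
      obtain ⟨l, hl, hlT, hln⟩ := H
      exact ih (T - l.length) (by omega) l hlT hln rfl

theorem OneShot.nonempty_NashIn [Nonempty A₁] [Nonempty A₂] {u₁ u₂ : A₁ → A₂ → ℝ} {T : ℕ}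
    {μ₁ : Hist A₁ A₂ → Mix A₁} {μ₂ : Hist A₁ A₂ → Mix A₂} (H : OneShot u₁ u₂ T μ₁ μ₂)
    (hT : 1 ≤ T) {P₁ : Set (Mix A₁)} {P₂ : Set (Mix A₂)} (h₁ : ∀ h, μ₁ h ∈ P₁)
    (h₂ : ∀ h, μ₂ h ∈ P₂) : (NashIn P₁ P₂ u₁ u₂).Nonempty := by
  let h : Hist A₁ A₂ := List.replicate (T - 1) (Classical.arbitrary _)
  have := H h 0 (by simp [h]; omega)
  have e : ∀ u : A₁ → A₂ → ℝ, augPay u μ₁ μ₂ 0 h = u := fun u => by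
    funext a b
    simp [augPay, totPay]
  rw [e, e] at this
  exact ⟨(μ₁ h, μ₂ h), this, h₁ h, h₂ h⟩

theorem OneShot.BR1m_of_const {u₁ u₂ : A₁ → A₂ → ℝ} {T : ℕ} {μ₁ : Hist A₁ A₂ → Mix A₁}
    {μ₂ : Hist A₁ A₂ → Mix A₂} (H : OneShot u₁ u₂ T μ₁ μ₂) {h : Hist A₁ A₂} {n : ℕ}
    (hn : h.length + (n + 1) = T) {v : ℝ}
    (hv : ∀ l : Hist A₁ A₂, h.length < l.length → l.length < T → expPay u₁ (μ₁ l) (μ₂ l) = v) :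
    BR1m u₁ (μ₁ h) (μ₂ h) := by
  have := (H h n hn).1
  have e : augPay u₁ μ₁ μ₂ n h = fun a b => u₁ a b + n * v := by
    funext a b
    rw [augPay, totPay_eq_mul (T := T) (k := h.length + 1) hv _ _ (by simp) (by simp; omega)]
  rwa [e, BR1m_add_const] at this

theorem OneShot.BR2m_of_const {u₁ u₂ : A₁ → A₂ → ℝ} {T : ℕ} {μ₁ : Hist A₁ A₂ → Mix A₁}
    {μ₂ : Hist A₁ A₂ → Mix A₂} (H : OneShot u₁ u₂ T μ₁ μ₂) {h : Hist A₁ A₂} {n : ℕ}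
    (hn : h.length + (n + 1) = T) {v : ℝ}
    (hv : ∀ l : Hist A₁ A₂, h.length < l.length → l.length < T → expPay u₂ (μ₁ l) (μ₂ l) = v) :
    BR2m u₂ (μ₁ h) (μ₂ h) := by
  have := (H h n hn).2
  have e : augPay u₂ μ₁ μ₂ n h = fun a b => u₂ a b + n * v := by
    funext a b
    rw [augPay, totPay_eq_mul (T := T) (k := h.length + 1) hv _ _ (by simp) (by simp; omega)]
  rwa [e, BR2m_add_const] at this

theorem totPay_condS_nil (u : A₁ → A₂ → ℝ) (μ₁ : Hist A₁ A₂ → Mix A₁)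
    (μ₂ : Hist A₁ A₂ → Mix A₂) (n : ℕ) (h : Hist A₁ A₂) :
    totPay u (condS μ₁ h) (condS μ₂ h) (n + 1) [] =
      expPay (augPay u μ₁ μ₂ n h) (μ₁ h) (μ₂ h) := by
  rw [totPay_condS, List.append_nil, totPay_succ]

variable [DecidableEq A₁] [DecidableEq A₂]

theorem totPay_update_left (u : A₁ → A₂ → ℝ) (μ₁ : Hist A₁ A₂ → Mix A₁)
    (μ₂ : Hist A₁ A₂ → Mix A₂) (n : ℕ) (h : Hist A₁ A₂) (τ : Mix A₁) :
    totPay u (Function.update (condS μ₁ h) [] τ) (condS μ₂ h) (n + 1) [] =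
      expPay (augPay u μ₁ μ₂ n h) τ (μ₂ h) := by
  have key : augPay u (Function.update (condS μ₁ h) [] τ) (condS μ₂ h) n [] =
      augPay u μ₁ μ₂ n h := by
    funext a b
    rw [augPay, augPay, ← totPay_condS u μ₁ μ₂ h]
    exact congrArg _ (totPay_congr u n (fun l => by simp) fun l => rfl)
  rw [totPay_succ, key]
  simp [condS]

theorem totPay_update_right (u : A₁ → A₂ → ℝ) (μ₁ : Hist A₁ A₂ → Mix A₁)
    (μ₂ : Hist A₁ A₂ → Mix A₂) (n : ℕ) (h : Hist A₁ A₂) (τ : Mix A₂) :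
    totPay u (condS μ₁ h) (Function.update (condS μ₂ h) [] τ) (n + 1) [] =
      expPay (augPay u μ₁ μ₂ n h) (μ₁ h) τ := by
  have key : augPay u (condS μ₁ h) (Function.update (condS μ₂ h) [] τ) n [] =
      augPay u μ₁ μ₂ n h := by
    funext a b
    rw [augPay, augPay, ← totPay_condS u μ₁ μ₂ h]
    exact congrArg _ (totPay_congr u n (fun l => rfl) fun l => by simp)
  rw [totPay_succ, key]
  simp [condS]

theorem isSPEmm_iff {u₁ u₂ : A₁ → A₂ → ℝ} {T : ℕ} {μ₁ : Hist A₁ A₂ → Mix A₁}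
    {μ₂ : Hist A₁ A₂ → Mix A₂} : isSPEmm u₁ u₂ T μ₁ μ₂ ↔ OneShot u₁ u₂ T μ₁ μ₂ := by
  refine ⟨fun H h n hn => ?_, OneShot.isSPEmm⟩
  have hNE := H h (by omega)
  rw [show T - h.length = n + 1 by omega] at hNE
  constructor
  · intro τ
    simpa only [totPay_update_left, totPay_condS_nil] using
      hNE.1 (Function.update (condS μ₁ h) [] τ)
  · intro τ
    simpa only [totPay_update_right, totPay_condS_nil] using
      hNE.2 (Function.update (condS μ₂ h) [] τ)

theorem isSPEmp_iff {u₁ u₂ : A₁ → A₂ → ℝ} {T : ℕ} {μ₁ : Hist A₁ A₂ → Mix A₁}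
    {μ₂ : Hist A₁ A₂ → A₂} :
    isSPEmp u₁ u₂ T μ₁ μ₂ ↔ OneShot u₁ u₂ T μ₁ (pureBeh2 μ₂) := by
  have hc : ∀ h, pureBeh2 (condS μ₂ h) = condS (pureBeh2 μ₂) h := fun h => rfl
  constructor
  · intro H h n hn
    have hNE := H h (by omega)
    rw [show T - h.length = n + 1 by omega] at hNE
    constructor
    · intro τ
      simpa only [hc, totPay_update_left, totPay_condS_nil] using
        hNE.1 (Function.update (condS μ₁ h) [] τ)
    · refine BR2m_iff.2 fun b => ?_
      have hu : pureBeh2 (Function.update (condS μ₂ h) [] b) =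
          Function.update (condS (pureBeh2 μ₂) h) [] (Mix.pure b) := by
        funext l
        by_cases hl : l = [] <;> simp [pureBeh2, condS, Function.update, hl]
      simpa only [hc, hu, totPay_update_right, totPay_condS_nil] using
        hNE.2 (Function.update (condS μ₂ h) [] b)
  · intro H h hT
    exact ⟨(H.isSPEmm h hT).1, fun ν => (H.isSPEmm h hT).2 (pureBeh2 ν)⟩

/-- Against a pure opponent, a sequence of stage equilibria gives player 1 a sum of equilibrium
payoffs, because player 1 is indifferent between all realized paths. -/
theorem OneShot.totPay_eq_sum {u₁ u₂ : A₁ → A₂ → ℝ} {T : ℕ} {μ₁ : Hist A₁ A₂ → Mix A₁}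
    {μ₂ : Hist A₁ A₂ → A₂} (H : OneShot u₁ u₂ T μ₁ (pureBeh2 μ₂)) {k : ℕ}
    (hk : ∀ l : Hist A₁ A₂, k ≤ l.length → l.length < T → (μ₁ l, μ₂ l) ∈ NashMP u₁ u₂) (n : ℕ)
    (h : Hist A₁ A₂) (hkh : k ≤ h.length) (hn : h.length + n = T) :
    ∃ q : Fin n → Mix A₁ × A₂, (∀ i, q i ∈ NashMP u₁ u₂) ∧
      totPay u₁ μ₁ (pureBeh2 μ₂) n h = ∑ i, expPay u₁ (q i).1 (Mix.pure (q i).2) := by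
  induction n generalizing h with
  | zero => exact ⟨Fin.elim0, fun i => i.elim0, by simp [totPay]⟩
  | succ n ih =>
    obtain ⟨a, ha⟩ := (μ₁ h).exists_pos
    obtain ⟨q, hq, hsum⟩ := ih (h ++ [(a, μ₂ h)]) (by simp; omega) (by simp; omega)
    have hN := hk h hkh (by omega)
    refine ⟨Fin.cons (μ₁ h, μ₂ h) q, fun i => ?_, ?_⟩
    · refine Fin.cases ?_ (fun i => ?_) i
      · exact hN
      · exact hq i
    · have e₁ := (H h n hn).1.eq_of_pos ha
      have e₂ := hN.1.eq_of_pos ha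
      simp only [pureBeh2, expPay_pure_pure] at e₁ e₂
      rw [Fin.sum_univ_succ, totPay_succ]
      simp only [Fin.cons_zero, Fin.cons_succ]
      rw [← hsum, ← e₂]
      exact e₁.symm

end RepeatedGame

section Construction

variable {A₁ A₂ : Type*} [Fintype A₁] [Fintype A₂]

/-- A profile that is not a stage equilibrium becomes one when each pair of observed actions is
followed by a suitable sequence of `T` stage equilibria. -/
def Supportable (P₁ : Set (Mix A₁)) (P₂ : Set (Mix A₂)) (u₁ u₂ : A₁ → A₂ → ℝ) : Prop :=
  ∃ (T : ℕ) (q : A₁ → A₂ → ℕ → Mix A₁ × Mix A₂) (σ₁ : Mix A₁) (σ₂ : Mix A₂),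
    (∀ a b t, q a b t ∈ NashIn P₁ P₂ u₁ u₂) ∧ σ₁ ∈ P₁ ∧ σ₂ ∈ P₂ ∧ (σ₁, σ₂) ∉ NashMM u₁ u₂ ∧
    BR1m (fun a b => u₁ a b + ∑ t ∈ range T, expPay u₁ (q a b t).1 (q a b t).2) σ₁ σ₂ ∧
    BR2m (fun a b => u₂ a b + ∑ t ∈ range T, expPay u₂ (q a b t).1 (q a b t).2) σ₁ σ₂

theorem swap_mem_NashIn {P₁ : Set (Mix A₁)} {P₂ : Set (Mix A₂)} {u₁ u₂ : A₁ → A₂ → ℝ}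
    {q : Mix A₂ × Mix A₁} :
    q.swap ∈ NashIn P₁ P₂ u₁ u₂ ↔ q ∈ NashIn P₂ P₁ (fun b a => u₂ a b) (fun b a => u₁ a b) := by
  change ((BR1m u₁ q.2 q.1 ∧ BR2m u₂ q.2 q.1) ∧ q.2 ∈ P₁ ∧ q.1 ∈ P₂) ↔
    ((BR1m (fun b a => u₂ a b) q.1 q.2 ∧ BR2m (fun b a => u₁ a b) q.1 q.2) ∧ q.1 ∈ P₂ ∧ q.2 ∈ P₁)
  rw [BR1m_flip (u := u₂), BR2m_flip (u := u₁)]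
  tauto

theorem Supportable.flip {P₁ : Set (Mix A₁)} {P₂ : Set (Mix A₂)} {u₁ u₂ : A₁ → A₂ → ℝ}
    (H : Supportable P₂ P₁ (fun b a => u₂ a b) (fun b a => u₁ a b)) :
    Supportable P₁ P₂ u₁ u₂ := by
  obtain ⟨T, q, σ₂, σ₁, hq, h₂, h₁, hn, hb₁, hb₂⟩ := H
  refine ⟨T, fun a b t => (q b a t).swap, σ₁, σ₂, fun a b t => swap_mem_NashIn.2 (hq b a t), h₁, h₂,
    fun h => hn ⟨BR1m_flip.2 h.2, BR2m_flip.2 h.1⟩, ?_, ?_⟩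
  · rw [← BR2m_flip]
    simpa only [expPay_flip, Prod.fst_swap, Prod.snd_swap] using hb₂
  · rw [← BR1m_flip]
    simpa only [expPay_flip, Prod.fst_swap, Prod.snd_swap] using hb₁

theorem Supportable.exists_oneShot {P₁ : Set (Mix A₁)} {P₂ : Set (Mix A₂)} {u₁ u₂ : A₁ → A₂ → ℝ}
    (H : Supportable P₁ P₂ u₁ u₂) :
    ∃ (T : ℕ) (μ₁ : Hist A₁ A₂ → Mix A₁) (μ₂ : Hist A₁ A₂ → Mix A₂),
      (∀ h, μ₁ h ∈ P₁) ∧ (∀ h, μ₂ h ∈ P₂) ∧ OneShot u₁ u₂ (T + 1) μ₁ μ₂ ∧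
      (μ₁ [], μ₂ []) ∉ NashMM u₁ u₂ := by
  obtain ⟨T, q, σ₁, σ₂, hq, h₁, h₂, hn, hb₁, hb₂⟩ := H
  let μ : Hist A₁ A₂ → Mix A₁ × Mix A₂ := fun h =>
    match h with
    | [] => (σ₁, σ₂)
    | (a, b) :: l => q a b l.length
  have htot : ∀ (u : A₁ → A₂ → ℝ) (n : ℕ) (a : A₁) (b : A₂) (l : Hist A₁ A₂),
      totPay u (fun h => (μ h).1) (fun h => (μ h).2) n ((a, b) :: l) =
        ∑ t ∈ range n, expPay u (q a b (l.length + t)).1 (q a b (l.length + t)).2 := by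
    intro u n
    induction n with
    | zero => intro a b l; simp [totPay]
    | succ n ih =>
      intro a b l
      have e : augPay u (fun h => (μ h).1) (fun h => (μ h).2) n ((a, b) :: l) =
          fun a' b' => u a' b' + ∑ t ∈ range n,
            expPay u (q a b (l.length + (t + 1))).1 (q a b (l.length + (t + 1))).2 := by
        funext a' b'
        rw [augPay, List.cons_append, ih]
        simp only [List.length_append, List.length_singleton, add_assoc, add_comm 1]
      rw [totPay_succ, e, expPay_add, expPay_const, Finset.sum_range_succ']
      simp [μ, add_comm]
  refine ⟨T, fun h => (μ h).1, fun h => (μ h).2, ?_, ?_, ?_, hn⟩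
  · rintro (_ | ⟨⟨a, b⟩, l⟩)
    exacts [h₁, (hq a b _).2.1]
  · rintro (_ | ⟨⟨a, b⟩, l⟩)
    exacts [h₂, (hq a b _).2.2]
  · rintro (_ | ⟨⟨a, b⟩, l⟩) n hT
    · obtain rfl : n = T := by simpa using hT
      have e : ∀ u : A₁ → A₂ → ℝ, augPay u (fun h => (μ h).1) (fun h => (μ h).2) n [] =
          fun a b => u a b + ∑ t ∈ range n, expPay u (q a b t).1 (q a b t).2 := fun u => by
        funext a b
        rw [augPay, List.nil_append, htot]
        simp
      rw [e, e]
      exact ⟨hb₁, hb₂⟩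
    · have e : ∀ u : A₁ → A₂ → ℝ, ∃ c, augPay u (fun h => (μ h).1) (fun h => (μ h).2) n
          ((a, b) :: l) = fun a' b' => u a' b' + c := fun u => by
        refine ⟨∑ t ∈ range n,
          expPay u (q a b (l.length + 1 + t)).1 (q a b (l.length + 1 + t)).2, ?_⟩
        funext a' b'
        rw [augPay, List.cons_append, htot]
        simp only [List.length_append, List.length_singleton]
      obtain ⟨c₁, e₁⟩ := e u₁
      obtain ⟨c₂, e₂⟩ := e u₂
      rw [e₁, e₂, BR1m_add_const, BR2m_add_const]
      exact (hq a b l.length).1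

theorem exists_forall_le_nat_mul {ι : Type*} [Finite ι] (f : ι → ℝ) {δ : ℝ} (hδ : 0 < δ) :
    ∃ K : ℕ, ∀ i, f i ≤ K * δ := by
  obtain ⟨M, hM⟩ := (Set.finite_range f).bddAbove
  obtain ⟨K, hK⟩ := exists_nat_ge (M / δ)
  exact ⟨K, fun i => (hM ⟨i, rfl⟩).trans ((div_le_iff₀ hδ).1 hK)⟩

theorem Supportable.GLSmm {u₁ u₂ : A₁ → A₂ → ℝ} (H : Supportable Set.univ Set.univ u₁ u₂) :
    GLSmm u₁ u₂ := by
  obtain ⟨T, μ₁, μ₂, -, -, hμ, hn⟩ := H.exists_oneShot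
  exact ⟨T + 1, by omega, μ₁, μ₂, hμ.isSPEmm, [], by simp, hn⟩

/-- If only player 1 has two equilibrium payoffs, a profile can be enforced as soon as player 2
best responds and a sequence of stage equilibria equalizes player 1's payoffs on the support. -/
theorem supportable_of_equalized [DecidableEq A₁] {P₁ : Set (Mix A₁)} {P₂ : Set (Mix A₂)}
    {u₁ u₂ : A₁ → A₂ → ℝ}
    {q r : Mix A₁ × Mix A₂} (hq : q ∈ NashIn P₁ P₂ u₁ u₂) (hr : r ∈ NashIn P₁ P₂ u₁ u₂)
    (hqr : expPay u₁ r.1 r.2 < expPay u₁ q.1 q.2) {v : ℝ}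
    (hv : ∀ q ∈ NashIn P₁ P₂ u₁ u₂, expPay u₂ q.1 q.2 = v) {σ₁ : Mix A₁} {σ₂ : Mix A₂}
    (h₁ : σ₁ ∈ P₁) (h₂ : σ₂ ∈ P₂) (hn : ¬ BR1m u₁ σ₁ σ₂) (hb : BR2m u₂ σ₁ σ₂) (T : ℕ)
    (s : A₁ → ℕ → Mix A₁ × Mix A₂) (hs : ∀ a t, s a t ∈ NashIn P₁ P₂ u₁ u₂)
    (heq : ∀ a a', 0 < σ₁.p a → 0 < σ₁.p a' →
      expPay u₁ (Mix.pure a) σ₂ + ∑ t ∈ range T, expPay u₁ (s a t).1 (s a t).2 =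
        expPay u₁ (Mix.pure a') σ₂ + ∑ t ∈ range T, expPay u₁ (s a' t).1 (s a' t).2) :
    Supportable P₁ P₂ u₁ u₂ := by
  let f : A₁ → ℝ := fun a =>
    expPay u₁ (Mix.pure a) σ₂ + ∑ t ∈ range T, expPay u₁ (s a t).1 (s a t).2
  obtain ⟨K, hK⟩ := exists_forall_le_nat_mul (fun p : A₁ × A₁ => f p.1 - f p.2) (sub_pos.2 hqr)
  let c : A₁ → ℝ := fun a => ∑ t ∈ range T, expPay u₁ (s a t).1 (s a t).2 +
    K * (if 0 < σ₁.p a then expPay u₁ q.1 q.2 else expPay u₁ r.1 r.2)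
  let s' : A₁ → ℕ → Mix A₁ × Mix A₂ := fun a t =>
    if t < T then s a t else if 0 < σ₁.p a then q else r
  have hs' : ∀ a t, s' a t ∈ NashIn P₁ P₂ u₁ u₂ := fun a t => by
    simp only [s']
    split_ifs
    exacts [hs a t, hq, hr]
  have hc : ∀ a, ∑ t ∈ range (T + K), expPay u₁ (s' a t).1 (s' a t).2 = c a := by
    intro a
    rw [Finset.sum_range_add]
    congr 1
    · refine Finset.sum_congr rfl fun t ht => ?_
      simp only [s', if_pos (Finset.mem_range.1 ht)]
    · simp only [s', add_lt_iff_neg_left, not_lt_zero, if_false]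
      split_ifs <;> simp
  refine ⟨T + K, fun a _ t => s' a t, σ₁, σ₂, fun a _ t => hs' a t, h₁, h₂, fun h => hn h.1, ?_, ?_⟩
  · simp only [hc]
    refine BR1m_of_pos fun a ha a' => ?_
    have hval : ∀ a, expPay (fun a b => u₁ a b + c a) (Mix.pure a) σ₂ =
        f a + K * (if 0 < σ₁.p a then expPay u₁ q.1 q.2 else expPay u₁ r.1 r.2) := fun a => by
      rw [expPay_add, expPay_of_left c]
      simp [Mix.pure, c, f, add_assoc]
    rw [hval, hval, if_pos ha]
    split_ifs with ha'
    · exact (add_left_inj _).2 (heq a' a ha' ha) |>.le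
    · linarith [hK (a', a)]
  · have e : ∀ a, ∑ t ∈ range (T + K), expPay u₂ (s' a t).1 (s' a t).2 =
        ∑ t ∈ range (T + K), v := fun a => Finset.sum_congr rfl fun t _ => hv _ (hs' a t)
    simp only [e]
    exact BR2m_add_const.2 hb

variable [DecidableEq A₁] [DecidableEq A₂]

theorem Supportable.GLSmp {u₁ u₂ : A₁ → A₂ → ℝ}
    (H : Supportable Set.univ (Set.range Mix.pure) u₁ u₂) : GLSmp u₁ u₂ := by
  obtain ⟨T, μ₁, μ₂, -, h₂, hμ, hn⟩ := H.exists_oneShot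
  choose ν hν using h₂
  obtain rfl : pureBeh2 ν = μ₂ := funext hν
  exact ⟨T + 1, by omega, μ₁, ν, isSPEmp_iff.2 hμ, [], by simp, fun h => hn (mem_NashMP_iff.1 h)⟩

/-- If each player has two stage equilibria with different payoffs, then any pure profile can be
enforced by rewards and punishments. -/
theorem supportable_of_two_values {P₁ : Set (Mix A₁)} {P₂ : Set (Mix A₂)} {u₁ u₂ : A₁ → A₂ → ℝ}
    (hP₁ : ∀ a, Mix.pure a ∈ P₁) (hP₂ : ∀ b, Mix.pure b ∈ P₂) {q₁ r₁ q₂ r₂ : Mix A₁ × Mix A₂}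
    (hq₁ : q₁ ∈ NashIn P₁ P₂ u₁ u₂) (hr₁ : r₁ ∈ NashIn P₁ P₂ u₁ u₂)
    (hq₂ : q₂ ∈ NashIn P₁ P₂ u₁ u₂) (hr₂ : r₂ ∈ NashIn P₁ P₂ u₁ u₂)
    (h₁ : expPay u₁ r₁.1 r₁.2 < expPay u₁ q₁.1 q₁.2)
    (h₂ : expPay u₂ r₂.1 r₂.2 < expPay u₂ q₂.1 q₂.2) {a : A₁} {b : A₂}
    (hn : (Mix.pure a, Mix.pure b) ∉ NashMM u₁ u₂) : Supportable P₁ P₂ u₁ u₂ := by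
  obtain ⟨K₁, hK₁⟩ := exists_forall_le_nat_mul (fun a' => u₁ a' b - u₁ a b) (sub_pos.2 h₁)
  obtain ⟨K₂, hK₂⟩ := exists_forall_le_nat_mul (fun b' => u₂ a b' - u₂ a b) (sub_pos.2 h₂)
  refine ⟨K₁ + K₂, fun a' b' t => if t < K₁ then (if a' = a then q₁ else r₁)
    else if b' = b then q₂ else r₂, Mix.pure a, Mix.pure b, ?_, hP₁ a, hP₂ b, hn, ?_, ?_⟩
  · intro a' b' t
    beta_reduce
    split_ifs <;> assumption
  all_goals
    have hs : ∀ (u : A₁ → A₂ → ℝ) (a' : A₁) (b' : A₂), (∑ t ∈ range (K₁ + K₂),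
        expPay u (if t < K₁ then (if a' = a then q₁ else r₁) else if b' = b then q₂ else r₂).1
          (if t < K₁ then (if a' = a then q₁ else r₁) else if b' = b then q₂ else r₂).2) =
        K₁ * (if a' = a then expPay u q₁.1 q₁.2 else expPay u r₁.1 r₁.2) +
        K₂ * (if b' = b then expPay u q₂.1 q₂.2 else expPay u r₂.1 r₂.2) := by
      intro u a' b'
      rw [Finset.sum_range_add]
      congr 1
      · rw [Finset.sum_congr rfl fun t ht => by rw [if_pos (Finset.mem_range.1 ht)]]
        split_ifs <;> simp
      · simp only [add_lt_iff_neg_left, not_lt_zero, if_false]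
        split_ifs <;> simp
    simp only [hs]
  · refine BR1m_iff.2 fun a' => ?_
    have := hK₁ a'
    by_cases ha : a' = a
    · simp [ha]
    · simp only [expPay_pure_pure, ha, if_true, if_false]
      linarith
  · refine BR2m_iff.2 fun b' => ?_
    have := hK₂ b'
    by_cases hb : b' = b
    · simp [hb]
    · simp only [expPay_pure_pure, hb, if_true, if_false]
      linarith

end Construction

section MixedMixed

/-- Moving along a segment from one payoff vector to another, if maximizers at the start have
`f ≥ 0` and maximizers at the end have `f ≤ 0`, then some interior point has maximizers of both
kinds. -/
theorem exists_maximizers_of_sign_change {B : Type*} [Finite B] [Nonempty B] (g g' f : B → ℝ)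
    (hg : ∀ b, (∀ b', g b' ≤ g b) → 0 ≤ f b) (hg' : ∀ b, (∀ b', g' b' ≤ g' b) → f b ≤ 0) :
    ∃ p ∈ Set.Ioo (0 : ℝ) 1, ∃ b₁ b₂, 0 ≤ f b₁ ∧ f b₂ ≤ 0 ∧
      (∀ b', (1 - p) * g b' + p * g' b' ≤ (1 - p) * g b₁ + p * g' b₁) ∧
      ∀ b', (1 - p) * g b' + p * g' b' ≤ (1 - p) * g b₂ + p * g' b₂ := by
  have near : ∀ g g' : B → ℝ, ∃ p ∈ Set.Ioo (0 : ℝ) 1, ∀ b,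
      (∀ b', (1 - p) * g b' + p * g' b' ≤ (1 - p) * g b + p * g' b) → ∀ b', g b' ≤ g b := by
    intro g g'
    have h : ∀ᶠ p : ℝ in nhdsWithin 0 (Set.Ioi 0), ∀ b b', g b < g b' →
        (1 - p) * g b + p * g' b < (1 - p) * g b' + p * g' b' := by
      refine Filter.eventually_all.2 fun b => Filter.eventually_all.2 fun b' => ?_
      by_cases hb : g b < g b'
      · have hc : ∀ b, Continuous fun p : ℝ => (1 - p) * g b + p * g' b := fun b => by fun_prop
        have := ContinuousAt.eventually_lt (x₀ := (0 : ℝ)) (hc b).continuousAt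
          (hc b').continuousAt (by simpa using hb)
        exact (this.filter_mono nhdsWithin_le_nhds).mono fun p hp _ => hp
      · exact Filter.Eventually.of_forall fun p h => absurd h hb
    obtain ⟨p, hp, hI⟩ := (h.and (Ioo_mem_nhdsGT one_pos)).exists
    refine ⟨p, hI, fun b hb b' => ?_⟩
    by_contra! hlt
    exact absurd (hp b b' hlt) (not_lt.2 (hb b'))
  let M : B → Set ℝ := fun b =>
    {p | ∀ b', (1 - p) * g b' + p * g' b' ≤ (1 - p) * g b + p * g' b}
  have hM : ∀ b, IsClosed (M b) := fun b => by
    simp only [M, Set.ofPred_forall]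
    exact isClosed_iInter fun b' => isClosed_le (by fun_prop) (by fun_prop)
  have hmax : ∀ p, ∃ b, p ∈ M b := fun p =>
    Finite.exists_max fun b => (1 - p) * g b + p * g' b
  have hclosed : ∀ Q : Set B, IsClosed (⋃ b ∈ Q, M b) := fun Q =>
    Q.toFinite.isClosed_biUnion fun b _ => hM b
  obtain ⟨p, hp, h₁, h₂⟩ := isPreconnected_closed_iff.1 (isPreconnected_Ioo (a := (0 : ℝ)) (b := 1))
    (⋃ b ∈ {b | 0 ≤ f b}, M b) (⋃ b ∈ {b | f b ≤ 0}, M b) (hclosed _) (hclosed _) (by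
      intro p _
      obtain ⟨b, hb⟩ := hmax p
      rcases le_total 0 (f b) with h | h
      · exact Or.inl (Set.mem_biUnion (x := b) h hb)
      · exact Or.inr (Set.mem_biUnion (x := b) h hb)) (by
      obtain ⟨p, hp, H⟩ := near g g'
      obtain ⟨b, hb⟩ := hmax p
      exact ⟨p, hp, Set.mem_biUnion (x := b) (hg b (H b hb)) hb⟩) (by
      obtain ⟨p, hp, H⟩ := near g' g
      obtain ⟨b, hb⟩ := hmax (1 - p)
      refine ⟨1 - p, ⟨by linarith [hp.2], by linarith [hp.1]⟩,
        Set.mem_biUnion (x := b) (hg' b (H b fun b' => ?_)) hb⟩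
      linarith [hb b'])
  simp only [Set.mem_iUnion, Set.mem_ofPred_eq, exists_prop] at h₁ h₂
  obtain ⟨b₁, hf₁, hb₁⟩ := h₁
  obtain ⟨b₂, hf₂, hb₂⟩ := h₂
  exact ⟨p, hp, b₁, b₂, hf₁, hf₂, hb₁, hb₂⟩

variable {A₁ A₂ : Type*} [Fintype A₁] [Fintype A₂] [DecidableEq A₁] [DecidableEq A₂]

/-- If a pure strategy of player 1 admits a continuum of equilibrium payoffs, every payoff vector
of player 1 can be equalized by stage equilibria. -/
theorem exists_equalizing_of_interval {u₁ u₂ : A₁ → A₂ → ℝ} {a₀ : A₁} {b b' : A₂}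
    (hN : ∀ θ (hθ : θ ∈ Set.Icc (0 : ℝ) 1),
      (Mix.pure a₀, Mix.lineMap θ hθ (Mix.pure b) (Mix.pure b')) ∈ NashMM u₁ u₂)
    (hlt : u₁ a₀ b < u₁ a₀ b') (f : A₁ → ℝ) :
    ∃ (T : ℕ) (s : A₁ → ℕ → Mix A₁ × Mix A₂) (C : ℝ), (∀ a t, s a t ∈ NashMM u₁ u₂) ∧
      ∀ a, f a + ∑ t ∈ range T, expPay u₁ (s a t).1 (s a t).2 = C := by
  obtain ⟨M, hM⟩ := (Set.finite_range f).bddAbove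
  have hM : ∀ a, f a ≤ M := fun a => hM ⟨a, rfl⟩
  have hδ := sub_pos.2 hlt
  obtain ⟨K, hK⟩ := exists_forall_le_nat_mul (fun a => M - f a) hδ
  have hpos : 0 < ((K + 1 : ℕ) : ℝ) * (u₁ a₀ b' - u₁ a₀ b) := by positivity
  have hθ : ∀ a, (M - f a) / (((K + 1 : ℕ) : ℝ) * (u₁ a₀ b' - u₁ a₀ b)) ∈ Set.Icc (0 : ℝ) 1 := by
    intro a
    refine ⟨div_nonneg (sub_nonneg.2 (hM a)) hpos.le, (div_le_one hpos).2 ?_⟩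
    push_cast
    linarith [hK a]
  refine ⟨K + 1, fun a _ => (Mix.pure a₀, Mix.lineMap _ (hθ a) (Mix.pure b) (Mix.pure b')),
    M + (K + 1 : ℕ) * u₁ a₀ b, fun a _ => hN _ _, fun a => ?_⟩
  simp only [expPay_lineMap_right, expPay_pure_pure, Finset.sum_const, Finset.card_range,
    nsmul_eq_mul]
  have hK0 : ((K + 1 : ℕ) : ℝ) ≠ 0 := by positivity
  field_simp
  ring

/-- If every pure strategy of player 1 is optimal against all best responses to it, and all
equilibria give player 2 the payoff `v`, then two pure strategies without common best response
yield an enforceable profile. -/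
theorem supportable_of_disjoint_responses [Nonempty A₂] {u₁ u₂ : A₁ → A₂ → ℝ}
    {q r : Mix A₁ × Mix A₂} (hq : q ∈ NashIn Set.univ Set.univ u₁ u₂)
    (hr : r ∈ NashIn Set.univ Set.univ u₁ u₂) (hqr : expPay u₁ r.1 r.2 < expPay u₁ q.1 q.2)
    {v : ℝ} (hv : ∀ q ∈ NashIn Set.univ Set.univ u₁ u₂, expPay u₂ q.1 q.2 = v)
    (hB : ∀ a τ₂, BR2m u₂ (Mix.pure a) τ₂ → BR1m u₁ (Mix.pure a) τ₂)
    (hle : ∀ a b, u₂ a b ≤ v) {a a' : A₁} (haa' : ∀ b, u₂ a b = v → u₂ a' b ≠ v) :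
    Supportable Set.univ Set.univ u₁ u₂ := by
  obtain ⟨p, hp, b₁, b₂, hf₁, hf₂, hb₁, hb₂⟩ := exists_maximizers_of_sign_change (u₂ a) (u₂ a')
    (fun b => u₁ a b - u₁ a' b)
    (fun b hb => by
      simpa using hB a (Mix.pure b) (BR2m_iff.2 (by simpa using hb)) (Mix.pure a'))
    (fun b hb => by
      simpa using hB a' (Mix.pure b) (BR2m_iff.2 (by simpa using hb)) (Mix.pure a))
  have hpI : p ∈ Set.Icc (0 : ℝ) 1 := ⟨hp.1.le, hp.2.le⟩
  let σ : Mix A₁ := Mix.lineMap p hpI (Mix.pure a) (Mix.pure a')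
  have hσ : ∀ b, expPay u₂ σ (Mix.pure b) = (1 - p) * u₂ a b + p * u₂ a' b := fun b => by
    simp [σ, expPay_lineMap_left]
  have hbr₁ : BR2m u₂ σ (Mix.pure b₁) := BR2m_iff.2 fun b => by simpa only [hσ] using hb₁ b
  have hbr₂ : BR2m u₂ σ (Mix.pure b₂) := BR2m_iff.2 fun b => by simpa only [hσ] using hb₂ b
  obtain ⟨θ, hθ, hθ0⟩ : ∃ θ ∈ Set.Icc (0 : ℝ) 1,
      (1 - θ) * (u₁ a b₁ - u₁ a' b₁) + θ * (u₁ a b₂ - u₁ a' b₂) = 0 := by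
    rcases hf₁.eq_or_lt with h | h
    · exact ⟨0, by simp, by rw [← h]; ring⟩
    · have hd : 0 < (u₁ a b₁ - u₁ a' b₁) - (u₁ a b₂ - u₁ a' b₂) := by linarith
      refine ⟨(u₁ a b₁ - u₁ a' b₁) / ((u₁ a b₁ - u₁ a' b₁) - (u₁ a b₂ - u₁ a' b₂)),
        ⟨div_nonneg h.le hd.le, (div_le_one hd).2 (by linarith)⟩, ?_⟩
      field_simp
      ring
  let τ : Mix A₂ := Mix.lineMap θ hθ (Mix.pure b₁) (Mix.pure b₂)
  have hbr : BR2m u₂ σ τ := hbr₁.lineMap hθ hbr₂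
  have hτ : expPay u₁ (Mix.pure a) τ = expPay u₁ (Mix.pure a') τ := by
    simp only [τ, expPay_lineMap_right, expPay_pure_pure]
    linarith
  have hlt : expPay u₂ σ τ < v := by
    rw [le_antisymm (hbr₁ τ) (hbr (Mix.pure b₁)), hσ]
    have h₁ := hle a b₁
    have h₂ := hle a' b₁
    rcases h₁.eq_or_lt with h | h
    · nlinarith [lt_of_le_of_ne h₂ (haa' b₁ h), hp.1, hp.2]
    · nlinarith [hp.1, hp.2]
  have hn : ¬ BR1m u₁ σ τ := fun h => hlt.ne (hv (σ, τ) ⟨⟨h, hbr⟩, trivial, trivial⟩)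
  have hsupp : ∀ c, 0 < σ.p c → expPay u₁ (Mix.pure c) τ = expPay u₁ (Mix.pure a) τ := by
    intro c hc
    by_cases h : c = a
    · rw [h]
    · by_cases h' : c = a'
      · rw [h', hτ]
      · simp [σ, Mix.lineMap, Mix.pure, h, h'] at hc
  refine supportable_of_equalized hq hr hqr hv trivial trivial hn hbr 0 (fun _ _ => q)
    (fun _ _ => hq) fun c c' hc hc' => ?_
  rw [hsupp c hc, hsupp c' hc']

theorem supportable_of_not_BR1m [Nonempty A₁] [Nonempty A₂] {u₁ u₂ : A₁ → A₂ → ℝ}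
    {q r : Mix A₁ × Mix A₂} (hq : q ∈ NashIn Set.univ Set.univ u₁ u₂)
    (hr : r ∈ NashIn Set.univ Set.univ u₁ u₂) (hqr : expPay u₁ r.1 r.2 < expPay u₁ q.1 q.2)
    {v : ℝ} (hv : ∀ q ∈ NashIn Set.univ Set.univ u₁ u₂, expPay u₂ q.1 q.2 = v) {σ₁ : Mix A₁}
    {σ₂ : Mix A₂} (hn : ¬ BR1m u₁ σ₁ σ₂) (hb : BR2m u₂ σ₁ σ₂) :
    Supportable Set.univ Set.univ u₁ u₂ := by
  by_cases hA : ∃ a τ₂, BR2m u₂ (Mix.pure a) τ₂ ∧ ¬ BR1m u₁ (Mix.pure a) τ₂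
  · obtain ⟨a, τ₂, hτ, hτn⟩ := hA
    refine supportable_of_equalized hq hr hqr hv trivial trivial hτn hτ 0 (fun _ _ => q)
      (fun _ _ => hq) fun c c' hc hc' => ?_
    rw [Mix.pure_pos_iff.1 hc, Mix.pure_pos_iff.1 hc']
  push Not at hA
  have hval : ∀ a b, BR2m u₂ (Mix.pure a) (Mix.pure b) → u₂ a b = v := fun a b h => by
    simpa using hv (Mix.pure a, Mix.pure b) ⟨⟨hA a _ h, h⟩, trivial, trivial⟩
  have hle : ∀ a b, u₂ a b ≤ v := fun a b => by
    obtain ⟨b', hb'⟩ := exists_BR2m_pure u₂ (Mix.pure a)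
    simpa [hval a b' hb'] using hb' (Mix.pure b)
  have hBR : ∀ a b, u₂ a b = v → BR2m u₂ (Mix.pure a) (Mix.pure b) := fun a b h =>
    BR2m_iff.2 fun b' => by simpa [h] using hle a b'
  by_cases hE : ∃ a a', ∀ b, u₂ a b = v → u₂ a' b ≠ v
  · obtain ⟨a, a', h⟩ := hE
    exact supportable_of_disjoint_responses hq hr hqr hv hA hle h
  push Not at hE
  by_cases hR : ∃ a b b', u₂ a b = v ∧ u₂ a b' = v ∧ u₁ a b < u₁ a b'
  · obtain ⟨a, b, b', h, h', hlt⟩ := hR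
    obtain ⟨T, s, C, hs, hC⟩ := exists_equalizing_of_interval (fun θ hθ =>
      have hbr := (hBR a b h).lineMap hθ (hBR a b' h')
      ⟨hA a _ hbr, hbr⟩) hlt fun a => expPay u₁ (Mix.pure a) σ₂
    exact supportable_of_equalized hq hr hqr hv trivial trivial hn hb T s
      (fun a t => ⟨hs a t, trivial, trivial⟩) fun a a' _ _ => by rw [hC, hC]
  push Not at hR
  have hR' : ∀ a b b', u₂ a b = v → u₂ a b' = v → u₁ a b = u₁ a b' := fun a b b' h h' =>
    le_antisymm (hR a b' b h' h) (hR a b b' h h')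
  let a₀ : A₁ := Classical.arbitrary A₁
  obtain ⟨b₀, hb₀, -⟩ := hE a₀ a₀
  have hw : ∀ a b, u₂ a b = v → u₁ a b = u₁ a₀ b₀ := by
    intro a b h
    obtain ⟨b₁, h₁, h₁'⟩ := hE a₀ a
    rw [hR' a b b₁ h h₁', hR' a₀ b₀ b₁ hb₀ h₁]
    have e₁ := hA a _ (hBR a b₁ h₁') (Mix.pure a₀)
    have e₂ := hA a₀ _ (hBR a₀ b₁ h₁) (Mix.pure a)
    simp only [expPay_pure_pure] at e₁ e₂
    exact le_antisymm e₂ e₁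
  have hN : ∀ x ∈ NashIn Set.univ Set.univ u₁ u₂, expPay u₁ x.1 x.2 = u₁ a₀ b₀ := by
    intro x hx
    have h₂ := hv x hx
    rw [expPay_eq_sum_left] at h₂ ⊢
    refine x.1.sum_mul_eq fun a ha => ?_
    have ha2 := x.1.eq_of_le_of_sum_eq (fun c _ => by
      rw [expPay_pure_left]
      exact x.2.sum_mul_le (hle c)) h₂ ha
    rw [expPay_pure_left] at ha2 ⊢
    exact x.2.sum_mul_eq fun b hb =>
      hw a b (x.2.eq_of_le_of_sum_eq (fun c _ => hle a c) ha2 hb)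
  rw [hN q hq, hN r hr] at hqr
  exact absurd hqr (lt_irrefl _)

end MixedMixed

section Characterization

variable {A₁ A₂ : Type*} [Fintype A₁] [Fintype A₂]

theorem oneVal_or_nontrivial {V : Set ℝ} (h : V.Nonempty) : oneVal V ∨ V.Nontrivial :=
  h.exists_eq_singleton_or_nontrivial

theorem oneVal.not_nontrivial {V : Set ℝ} (h : oneVal V) : ¬ V.Nontrivial := by
  obtain ⟨v, rfl⟩ := h
  exact Set.not_nontrivial_singleton

theorem exists_eq_of_oneVal_image {α : Type*} {f : α → ℝ} {s : Set α} (h : oneVal (f '' s)) :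
    ∃ v, ∀ x ∈ s, f x = v := by
  obtain ⟨v, hv⟩ := h
  exact ⟨v, fun x hx => hv.subset ⟨x, hx, rfl⟩⟩

theorem exists_lt_of_nontrivial_image {α : Type*} {f : α → ℝ} {s : Set α}
    (h : (f '' s).Nontrivial) : ∃ x ∈ s, ∃ y ∈ s, f y < f x := by
  obtain ⟨_, ⟨y, hy, rfl⟩, _, ⟨x, hx, rfl⟩, hlt⟩ := h.exists_lt
  exact ⟨x, hx, y, hy, hlt⟩

/-- At a last locally suboptimal history, a player whose stage equilibrium payoffs all coincide
best responds, hence the other player does not and has several stage equilibrium payoffs. -/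
theorem OneShot.exists_last_suboptimal_cases [Nonempty A₁] [Nonempty A₂] {u₁ u₂ : A₁ → A₂ → ℝ}
    {T : ℕ} {μ₁ : Hist A₁ A₂ → Mix A₁} {μ₂ : Hist A₁ A₂ → Mix A₂} (H : OneShot u₁ u₂ T μ₁ μ₂)
    {P₁ : Set (Mix A₁)} {P₂ : Set (Mix A₂)} (hP₁ : ∀ h, μ₁ h ∈ P₁) (hP₂ : ∀ h, μ₂ h ∈ P₂)
    {l : Hist A₁ A₂} (hl : l.length < T) (hn : (μ₁ l, μ₂ l) ∉ NashMM u₁ u₂) {V₁ V₂ : Set ℝ}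
    (hV₁ : (fun q : Mix A₁ × Mix A₂ => expPay u₁ q.1 q.2) '' NashIn P₁ P₂ u₁ u₂ = V₁)
    (hV₂ : (fun q : Mix A₁ × Mix A₂ => expPay u₂ q.1 q.2) '' NashIn P₁ P₂ u₁ u₂ = V₂) :
    ∃ (h : Hist A₁ A₂) (n : ℕ), h.length + (n + 1) = T ∧ (μ₁ h, μ₂ h) ∉ NashMM u₁ u₂ ∧
      (∀ l : Hist A₁ A₂, h.length < l.length → l.length < T → (μ₁ l, μ₂ l) ∈ NashMM u₁ u₂) ∧
      (V₁.Nontrivial ∧ V₂.Nontrivial ∨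
        V₁.Nontrivial ∧ oneVal V₂ ∧ ¬ BR1m u₁ (μ₁ h) (μ₂ h) ∧ BR2m u₂ (μ₁ h) (μ₂ h) ∨
        oneVal V₁ ∧ V₂.Nontrivial ∧ ¬ BR2m u₂ (μ₁ h) (μ₂ h) ∧ BR1m u₁ (μ₁ h) (μ₂ h)) := by
  subst hV₁ hV₂
  obtain ⟨h, n, hT, hn, hN⟩ := exists_last_suboptimal l hl hn
  refine ⟨h, n, hT, hn, hN, ?_⟩
  have hne := H.nonempty_NashIn (by omega) hP₁ hP₂
  have hN' : ∀ l : Hist A₁ A₂, h.length < l.length → l.length < T →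
      (μ₁ l, μ₂ l) ∈ NashIn P₁ P₂ u₁ u₂ := fun l h₁ h₂ => ⟨hN l h₁ h₂, hP₁ l, hP₂ l⟩
  have hB₁ : oneVal ((fun q : Mix A₁ × Mix A₂ => expPay u₁ q.1 q.2) '' NashIn P₁ P₂ u₁ u₂) →
      BR1m u₁ (μ₁ h) (μ₂ h) := fun hV => by
    obtain ⟨v, hv⟩ := exists_eq_of_oneVal_image hV
    exact H.BR1m_of_const hT fun l h₁ h₂ => hv _ (hN' l h₁ h₂)
  have hB₂ : oneVal ((fun q : Mix A₁ × Mix A₂ => expPay u₂ q.1 q.2) '' NashIn P₁ P₂ u₁ u₂) →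
      BR2m u₂ (μ₁ h) (μ₂ h) := fun hV => by
    obtain ⟨v, hv⟩ := exists_eq_of_oneVal_image hV
    exact H.BR2m_of_const hT fun l h₁ h₂ => hv _ (hN' l h₁ h₂)
  rcases oneVal_or_nontrivial (hne.image fun q => expPay u₁ q.1 q.2) with h₁ | h₁ <;>
    rcases oneVal_or_nontrivial (hne.image fun q => expPay u₂ q.1 q.2) with h₂ | h₂
  · exact absurd ⟨hB₁ h₁, hB₂ h₂⟩ hn
  · exact .inr (.inr ⟨h₁, h₂, fun h => hn ⟨hB₁ h₁, h⟩, hB₁ h₁⟩)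
  · exact .inr (.inl ⟨h₁, h₂, fun h => hn ⟨h, hB₂ h₂⟩, hB₂ h₂⟩)
  · exact .inl ⟨h₁, h₂⟩

theorem not_BR1m_iff [DecidableEq A₁] {u : A₁ → A₂ → ℝ} {σ₁ : Mix A₁} {σ₂ : Mix A₂} :
    ¬ BR1m u σ₁ σ₂ ↔ ∃ a, expPay u σ₁ σ₂ < expPay u (Mix.pure a) σ₂ := by
  rw [BR1m_iff]
  push Not
  rfl

theorem not_BR2m_iff [DecidableEq A₂] {u : A₁ → A₂ → ℝ} {σ₁ : Mix A₁} {σ₂ : Mix A₂} :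
    ¬ BR2m u σ₁ σ₂ ↔ ∃ b, expPay u σ₁ σ₂ < expPay u σ₁ (Mix.pure b) := by
  rw [BR2m_iff]
  push Not
  rfl

theorem condMP.nontrivial [DecidableEq A₂] {u₁ u₂ : A₁ → A₂ → ℝ} (h : condMP u₁ u₂) :
    (V1mp u₁ u₂).Nontrivial ∨ (V2mp u₁ u₂).Nontrivial := by
  obtain ⟨h, -⟩ | ⟨h, -⟩ | ⟨-, h, -⟩ := h
  exacts [.inl h, .inl h, .inr h]

variable [DecidableEq A₁] [DecidableEq A₂]

theorem exists_pure_notMem_NashMM {u₁ u₂ : A₁ → A₂ → ℝ} {σ₁ : Mix A₁} {σ₂ : Mix A₂}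
    (h : (σ₁, σ₂) ∉ NashMM u₁ u₂) : ∃ a b, (Mix.pure a, Mix.pure b) ∉ NashMM u₁ u₂ := by
  by_contra! hN
  exact h (forall_mem_NashMM_of_pure hN σ₁ σ₂)

theorem GLSmm_iff [Nonempty A₁] [Nonempty A₂] (u₁ u₂ : A₁ → A₂ → ℝ) :
    GLSmm u₁ u₂ ↔ condMM u₁ u₂ := by
  constructor
  · rintro ⟨T, -, μ₁, μ₂, hμ, l, hl, hn⟩
    obtain ⟨h, n, -, hn, -, hc⟩ := (isSPEmm_iff.1 hμ).exists_last_suboptimal_cases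
      (fun _ => Set.mem_univ _) (fun _ => Set.mem_univ _) hl hn rfl rfl
    rw [NashIn_univ] at hc
    rcases hc with ⟨h₁, h₂⟩ | ⟨h₁, h₂, hB, hB'⟩ | ⟨h₁, h₂, hB, hB'⟩
    · exact .inl ⟨h₁, h₂, _, _, hn⟩
    · obtain ⟨a, ha⟩ := not_BR1m_iff.1 hB
      exact .inr (.inl ⟨h₁, h₂, _, _, a, ha, hB'⟩)
    · obtain ⟨b, hb⟩ := not_BR2m_iff.1 hB
      exact .inr (.inr ⟨h₁, h₂, _, _, b, hb, hB'⟩)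
  · have hN := NashIn_univ u₁ u₂
    rintro (⟨h₁, h₂, σ₁, σ₂, hn⟩ | ⟨h₁, h₂, σ₁, σ₂, a, ha, hB⟩ | ⟨h₁, h₂, σ₁, σ₂, b, hb, hB⟩)
    · rw [V1mm, ← hN] at h₁
      rw [V2mm, ← hN] at h₂
      obtain ⟨q₁, hq₁, r₁, hr₁, h₁⟩ := exists_lt_of_nontrivial_image h₁
      obtain ⟨q₂, hq₂, r₂, hr₂, h₂⟩ := exists_lt_of_nontrivial_image h₂
      obtain ⟨a, b, hab⟩ := exists_pure_notMem_NashMM hn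
      exact (supportable_of_two_values (P₁ := Set.univ) (P₂ := Set.univ) (fun _ => trivial)
        (fun _ => trivial) hq₁ hr₁ hq₂ hr₂ h₁ h₂ hab).GLSmm
    · rw [V1mm, ← hN] at h₁
      rw [V2mm, ← hN] at h₂
      obtain ⟨q, hq, r, hr, h₁⟩ := exists_lt_of_nontrivial_image h₁
      obtain ⟨v, hv⟩ := exists_eq_of_oneVal_image h₂
      exact (supportable_of_not_BR1m hq hr h₁ hv (not_BR1m_iff.2 ⟨a, ha⟩) hB).GLSmm
    · rw [V1mm, ← hN] at h₁
      rw [V2mm, ← hN] at h₂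
      obtain ⟨q, hq, r, hr, h₂⟩ := exists_lt_of_nontrivial_image h₂
      obtain ⟨v, hv⟩ := exists_eq_of_oneVal_image h₁
      refine (Supportable.flip (supportable_of_not_BR1m ((swap_mem_NashIn (q := q.swap)).1 hq)
        ((swap_mem_NashIn (q := r.swap)).1 hr) ?_ (v := v) (fun p hp => ?_)
        ((BR1m_flip (u := u₂)).not.2 (not_BR2m_iff.2 ⟨b, hb⟩)) ((BR2m_flip (u := u₁)).2 hB))).GLSmm
      · simpa only [expPay_flip, Prod.fst_swap, Prod.snd_swap] using h₂
      · rw [expPay_flip]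
        exact hv p.swap (swap_mem_NashIn.2 hp)

theorem sumOfD_zero (D : Set ℝ) : sumOfD D 0 :=
  ⟨0, Fin.elim0, fun k => k.elim0, by simp⟩

/-- Sums of differences of player 1's stage equilibrium payoffs can be generated, up to a common
constant, by finite sequences of stage equilibria. -/
theorem exists_equilibria_of_sumOfD {u₁ u₂ : A₁ → A₂ → ℝ} {q₀ : Mix A₁ × Mix A₂}
    (hq₀ : q₀ ∈ NashIn Set.univ (Set.range Mix.pure) u₁ u₂) {f : A₁ → ℝ}
    (hf : ∀ a, sumOfD (Dmp u₁ u₂) (f a)) (F : Finset A₁) :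
    ∃ (T : ℕ) (s : A₁ → ℕ → Mix A₁ × Mix A₂) (C : ℝ),
      (∀ a t, s a t ∈ NashIn Set.univ (Set.range Mix.pure) u₁ u₂) ∧
      ∀ a, ∑ t ∈ range T, expPay u₁ (s a t).1 (s a t).2 = C + if a ∈ F then f a else 0 := by
  induction F using Finset.induction_on with
  | empty => exact ⟨0, fun _ _ => q₀, 0, fun _ _ => hq₀, by simp⟩
  | insert c F hc ih =>
    obtain ⟨T, s, C, hs, hC⟩ := ih
    obtain ⟨n, d, hd, hfd⟩ := hf c
    choose Q hQ R hR hdQ using hd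
    let E : (Fin n → Mix A₁ × A₂) → ℕ → Mix A₁ × Mix A₂ := fun P t =>
      if ht : t < n then ((P ⟨t, ht⟩).1, Mix.pure (P ⟨t, ht⟩).2) else q₀
    have hE : ∀ P : Fin n → Mix A₁ × A₂, (∀ k, P k ∈ NashMP u₁ u₂) →
        ∀ t, E P t ∈ NashIn Set.univ (Set.range Mix.pure) u₁ u₂ := fun P hP t => by
      by_cases ht : t < n
      · simp only [E, ht, dite_true]
        exact ⟨mem_NashMP_iff.1 (hP _), trivial, _, rfl⟩
      · simpa only [E, ht, dite_false] using hq₀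
    have hsum : ∀ P : Fin n → Mix A₁ × A₂, ∑ t ∈ range n, expPay u₁ (E P t).1 (E P t).2 =
        ∑ k, expPay u₁ (P k).1 (Mix.pure (P k).2) := fun P => by
      rw [Finset.sum_range]
      simp [E]
    refine ⟨T + n, fun a t => if t < T then s a t else
      if a = c then E Q (t - T) else E R (t - T),
      C + ∑ k, expPay u₁ (R k).1 (Mix.pure (R k).2), fun a t => ?_, fun a => ?_⟩
    · beta_reduce
      split_ifs
      exacts [hs a t, hE Q hQ _, hE R hR _]
    · beta_reduce
      rw [Finset.sum_range_add, Finset.sum_congr rfl fun t ht => by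
        rw [if_pos (Finset.mem_range.1 ht)], hC]
      simp only [add_lt_iff_neg_left, not_lt_zero, if_false, add_tsub_cancel_left]
      by_cases ha : a = c
      · subst ha
        simp only [if_true, hsum, hc, if_false, Finset.mem_insert_self, hfd, hdQ,
          Finset.sum_sub_distrib]
        ring
      · simp only [ha, if_false, hsum, Finset.mem_insert, false_or]
        ring

/-- Indifference of player 1 at a last locally suboptimal history expresses stage payoff
differences as sums of differences of equilibrium payoffs. -/
theorem OneShot.sumOfD_sub {u₁ u₂ : A₁ → A₂ → ℝ} {T : ℕ} {μ₁ : Hist A₁ A₂ → Mix A₁}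
    {μ₂ : Hist A₁ A₂ → A₂} (H : OneShot u₁ u₂ T μ₁ (pureBeh2 μ₂)) {h : Hist A₁ A₂} {n : ℕ}
    (hT : h.length + (n + 1) = T)
    (hN : ∀ l : Hist A₁ A₂, h.length < l.length → l.length < T →
      (μ₁ l, μ₂ l) ∈ NashMP u₁ u₂) {a a' : A₁} (ha : 0 < (μ₁ h).p a) (ha' : 0 < (μ₁ h).p a') :
    sumOfD (Dmp u₁ u₂) (u₁ a (μ₂ h) - u₁ a' (μ₂ h)) := by
  have hB := (H h n hT).1
  have heq := (hB.eq_of_pos ha).trans (hB.eq_of_pos ha').symm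
  simp only [pureBeh2, expPay_pure_pure, augPay] at heq
  obtain ⟨q, hq, hqs⟩ := H.totPay_eq_sum (k := h.length + 1) hN n (h ++ [(a, μ₂ h)]) (by simp)
    (by simp; omega)
  obtain ⟨q', hq', hqs'⟩ := H.totPay_eq_sum (k := h.length + 1) hN n (h ++ [(a', μ₂ h)]) (by simp)
    (by simp; omega)
  refine ⟨n, fun k => expPay u₁ (q' k).1 (Mix.pure (q' k).2) - expPay u₁ (q k).1
    (Mix.pure (q k).2), fun k => ⟨_, hq' k, _, hq k, rfl⟩, ?_⟩
  rw [Finset.sum_sub_distrib, ← hqs, ← hqs']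
  linarith

theorem condMP_of_GLSmp [Nonempty A₁] [Nonempty A₂] {u₁ u₂ : A₁ → A₂ → ℝ} (H : GLSmp u₁ u₂) :
    condMP u₁ u₂ := by
  obtain ⟨T, -, μ₁, μ₂, hμ, l, hl, hn⟩ := H
  have H := isSPEmp_iff.1 hμ
  obtain ⟨h, n, hT, hn, hN, hc⟩ := H.exists_last_suboptimal_cases (P₁ := Set.univ)
    (P₂ := Set.range Mix.pure) (fun _ => trivial) (fun _ => ⟨_, rfl⟩) hl
    (fun h => hn (mem_NashMP_iff.2 h)) (image_NashMP u₁ u₁ u₂).symm (image_NashMP u₂ u₁ u₂).symm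
  rcases hc with ⟨h₁, h₂⟩ | ⟨h₁, h₂, hB, hB'⟩ | ⟨h₁, h₂, hB, hB'⟩
  · exact .inl ⟨h₁, h₂, μ₁ h, μ₂ h, fun h => hn (mem_NashMP_iff.1 h)⟩
  · obtain ⟨a', ha'⟩ := not_BR1m_iff.1 hB
    refine .inr (.inl ⟨h₁, h₂, μ₁ h, a', μ₂ h, by simpa only [pureBeh2, expPay_pure_pure] using ha',
      BR2pm_iff.2 hB', fun ⟨a, ha, _⟩ => ⟨a, ha, fun a' ha' _ => ?_⟩⟩)
    exact H.sumOfD_sub hT (fun l h₁ h₂ => mem_NashMP_iff.2 (hN l h₁ h₂)) ha ha'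
  · obtain ⟨b, hb⟩ := not_BR2m_iff.1 hB
    exact .inr (.inr ⟨h₁, h₂, μ₁ h, μ₂ h, b, hb, hB'⟩)

theorem GLSmp_of_condMP {u₁ u₂ : A₁ → A₂ → ℝ} (H : condMP u₁ u₂) : GLSmp u₁ u₂ := by
  rw [condMP, V1mp, V2mp, image_NashMP, image_NashMP] at H
  obtain ⟨h₁, h₂, σ₁, a₂, hn⟩ | ⟨h₁, h₂, σ₁, a₁, a₂, ha₁, hB, hD⟩ | ⟨h₁, h₂, σ₁, b, b', hb, hB⟩ := H
  · obtain ⟨q₁, hq₁, r₁, hr₁, h₁⟩ := exists_lt_of_nontrivial_image h₁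
    obtain ⟨q₂, hq₂, r₂, hr₂, h₂⟩ := exists_lt_of_nontrivial_image h₂
    obtain ⟨a, b, hab⟩ := exists_pure_notMem_NashMM (mem_NashMP_iff.not.1 hn)
    exact (supportable_of_two_values (P₁ := Set.univ) (P₂ := Set.range Mix.pure) (fun _ => trivial)
      (fun b => ⟨b, rfl⟩) hq₁ hr₁ hq₂ hr₂ h₁ h₂ hab).GLSmp
  · obtain ⟨q, hq, r, hr, h₁⟩ := exists_lt_of_nontrivial_image h₁
    obtain ⟨v, hv⟩ := exists_eq_of_oneVal_image h₂
    obtain ⟨a, ha, hD⟩ : ∃ a ∈ σ₁.support, ∀ a' ∈ σ₁.support, a' ≠ a →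
        sumOfD (Dmp u₁ u₂) (u₁ a a₂ - u₁ a' a₂) := by
      by_cases hS : σ₁.support.Nontrivial
      · exact hD hS
      · obtain ⟨a, ha⟩ := σ₁.exists_pos
        exact ⟨a, ha, fun a' ha' hne => absurd (Set.not_nontrivial_iff.1 hS ha' ha) hne⟩
    classical
    obtain ⟨T, s, C, hs, hC⟩ := exists_equilibria_of_sumOfD hq
      (f := fun a' => if a' ∈ σ₁.support ∧ a' ≠ a then u₁ a a₂ - u₁ a' a₂ else 0)
      (fun a' => by
        split_ifs with h
        exacts [hD a' h.1 h.2, sumOfD_zero _]) Finset.univ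
    have hval : ∀ a', 0 < σ₁.p a' → expPay u₁ (Mix.pure a') (Mix.pure a₂) +
        ∑ t ∈ range T, expPay u₁ (s a' t).1 (s a' t).2 = u₁ a a₂ + C := fun a' ha' => by
      have hS : a' ∈ σ₁.support := ha'
      rw [hC, expPay_pure_pure]
      by_cases h : a' = a
      · simp [h]
      · simp only [hS, h, Finset.mem_univ, ne_eq, not_false_eq_true, and_self, if_true]
        ring
    exact (supportable_of_equalized hq hr h₁ hv trivial ⟨a₂, rfl⟩
      (not_BR1m_iff.2 ⟨a₁, by simpa only [expPay_pure_pure] using ha₁⟩) (BR2pm_iff.1 hB) T s hs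
      fun c c' hc hc' => (hval c hc).trans (hval c' hc').symm).GLSmp
  · obtain ⟨q, hq, r, hr, h₂⟩ := exists_lt_of_nontrivial_image h₂
    obtain ⟨v, hv⟩ := exists_eq_of_oneVal_image h₁
    refine (Supportable.flip (supportable_of_equalized ((swap_mem_NashIn (q := q.swap)).1 hq)
      ((swap_mem_NashIn (q := r.swap)).1 hr) ?_ (v := v) (fun p hp => ?_) ⟨b, rfl⟩ trivial
      ((BR1m_flip (u := u₂)).not.2 (not_BR2m_iff.2 ⟨b', hb⟩)) ((BR2m_flip (u := u₁)).2 hB) 0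
      (fun _ _ => q.swap)
      (fun _ _ => (swap_mem_NashIn (q := q.swap)).1 hq) fun c c' hc hc' => ?_)).GLSmp
    · simpa only [expPay_flip, Prod.fst_swap, Prod.snd_swap] using h₂
    · rw [expPay_flip]
      exact hv p.swap (swap_mem_NashIn.2 hp)
    · rw [Mix.pure_pos_iff.1 hc, Mix.pure_pos_iff.1 hc']

theorem GLSmp_iff [Nonempty A₁] [Nonempty A₂] (u₁ u₂ : A₁ → A₂ → ℝ) :
    GLSmp u₁ u₂ ↔ condMP u₁ u₂ :=
  ⟨condMP_of_GLSmp, GLSmp_of_condMP⟩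

theorem condMM.exists_notMem_NashMM {u₁ u₂ : A₁ → A₂ → ℝ} (h : condMM u₁ u₂) :
    ∃ σ₁ σ₂, (σ₁, σ₂) ∉ NashMM u₁ u₂ := by
  obtain ⟨-, -, σ₁, σ₂, hn⟩ | ⟨-, -, σ₁, σ₂, a, ha, -⟩ | ⟨-, -, σ₁, σ₂, b, hb, -⟩ := h
  · exact ⟨σ₁, σ₂, hn⟩
  · exact ⟨σ₁, σ₂, fun h => not_BR1m_iff.2 ⟨a, ha⟩ h.1⟩
  · exact ⟨σ₁, σ₂, fun h => not_BR2m_iff.2 ⟨b, hb⟩ h.2⟩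

theorem condMP_of_nontrivial {u₁ u₂ : A₁ → A₂ → ℝ} (h₁ : (V1mp u₁ u₂).Nontrivial)
    (h₂ : (V2mp u₁ u₂).Nontrivial) (h : condMM u₁ u₂) : condMP u₁ u₂ := by
  obtain ⟨σ₁, σ₂, hn⟩ := h.exists_notMem_NashMM
  obtain ⟨a, b, hab⟩ := exists_pure_notMem_NashMM hn
  exact .inl ⟨h₁, h₂, Mix.pure a, b, mem_NashMP_iff.not.2 hab⟩

end Characterization

section TwoPlayer
variable {A₁ A₂ : Type*} [Fintype A₁] [Fintype A₂] [DecidableEq A₁] [DecidableEq A₂]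
variable [Nonempty A₁] [Nonempty A₂]

/-- Characterization of `𝒢_LS^{m,m} \\ 𝒢_LS^{m,p}`. -/
theorem GLSmm_diff_GLSmp_iff (u₁ u₂ : A₁ → A₂ → ℝ) :
    (¬ GLSmp u₁ u₂ ∧ GLSmm u₁ u₂) ↔
      ((V1mp u₁ u₂ = ∅ ∧ V2mp u₁ u₂ = ∅ ∧ condMM u₁ u₂) ∨
       (oneVal (V1mp u₁ u₂) ∧ oneVal (V2mp u₁ u₂) ∧ condMM u₁ u₂) ∨
       ((V1mp u₁ u₂).Nontrivial ∧ oneVal (V2mp u₁ u₂) ∧ ¬ condMP u₁ u₂ ∧ condMM u₁ u₂) ∨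
       (oneVal (V1mp u₁ u₂) ∧ (V2mp u₁ u₂).Nontrivial ∧ ¬ condMP u₁ u₂ ∧
         condMM u₁ u₂)) := by
  rw [GLSmm_iff, GLSmp_iff]
  constructor
  · rintro ⟨hP, hM⟩
    rcases (NashMP u₁ u₂).eq_empty_or_nonempty with h | h
    · exact .inl ⟨by rw [V1mp, h, Set.image_empty], by rw [V2mp, h, Set.image_empty], hM⟩
    · rcases oneVal_or_nontrivial (V := V1mp u₁ u₂) (h.image _) with h₁ | h₁ <;>
        rcases oneVal_or_nontrivial (V := V2mp u₁ u₂) (h.image _) with h₂ | h₂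
      · exact .inr (.inl ⟨h₁, h₂, hM⟩)
      · exact .inr (.inr (.inr ⟨h₁, h₂, hP, hM⟩))
      · exact .inr (.inr (.inl ⟨h₁, h₂, hP, hM⟩))
      · exact absurd (condMP_of_nontrivial h₁ h₂ hM) hP
  · rintro (⟨h₁, h₂, hM⟩ | ⟨h₁, h₂, hM⟩ | ⟨-, -, hP, hM⟩ | ⟨-, -, hP, hM⟩)
    · refine ⟨fun h => h.nontrivial.elim ?_ ?_, hM⟩ <;> simp [h₁, h₂]
    · exact ⟨fun h => h.nontrivial.elim h₁.not_nontrivial h₂.not_nontrivial, hM⟩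
    · exact ⟨hP, hM⟩
    · exact ⟨hP, hM⟩

end TwoPlayer
end

section
/- For every 2-player stage game G with |V₁^{p,p}| > 1 and |V₂^{p,p}| > 1: if G ∈ 𝒢_LS^{m,m} (local suboptimality occurs in some SPE of some G(T) when both players may use mixed strategies), then G ∈ 𝒢_LS^{p,p} (local suboptimality occurs in some SPE of some G(T) when both players use only pure strategies). -/
open Finset

theorem expPay_eq_of_forall_left {A₁ A₂ : Type*} [Fintype A₁] [Fintype A₂]
    {u : A₁ → A₂ → ℝ} {f : A₂ → ℝ} (hu : ∀ a b, u a b = f b)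
    (σ₁ : Mix A₁) (σ₂ : Mix A₂) : expPay u σ₁ σ₂ = ∑ b, σ₂.p b * f b := by
  simp only [expPay, hu, mul_assoc, ← Finset.mul_sum, ← Finset.sum_mul, σ₁.sum_one, one_mul]

theorem expPay_eq_of_forall_right {A₁ A₂ : Type*} [Fintype A₁] [Fintype A₂]
    {u : A₁ → A₂ → ℝ} {f : A₁ → ℝ} (hu : ∀ a b, u a b = f a)
    (σ₁ : Mix A₁) (σ₂ : Mix A₂) : expPay u σ₁ σ₂ = ∑ a, σ₁.p a * f a := by
  simp only [expPay, hu, ← Finset.mul_sum, ← Finset.sum_mul, σ₂.sum_one, mul_one]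

/-- If every pure profile is a Nash equilibrium, then so is every mixed profile. -/
theorem mem_NashMM_of_forall_mem_NashPP {A₁ A₂ : Type*} [Fintype A₁] [Fintype A₂] [Nonempty A₁]
    [Nonempty A₂] {u₁ u₂ : A₁ → A₂ → ℝ} (hN : ∀ q, q ∈ NashPP u₁ u₂)
    (q : Mix A₁ × Mix A₂) : q ∈ NashMM u₁ u₂ := by
  obtain ⟨a₀⟩ := ‹Nonempty A₁›
  obtain ⟨b₀⟩ := ‹Nonempty A₂›
  have h₁ : ∀ a b, u₁ a b = u₁ a₀ b := fun a b =>
    le_antisymm ((hN (a₀, b)).1 a) ((hN (a, b)).1 a₀)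
  have h₂ : ∀ a b, u₂ a b = u₂ a b₀ := fun a b =>
    le_antisymm ((hN (a, b₀)).2 b) ((hN (a, b)).2 b₀)
  constructor
  · intro τ
    rw [expPay_eq_of_forall_left h₁, expPay_eq_of_forall_left h₁]
  · intro τ
    rw [expPay_eq_of_forall_right h₂, expPay_eq_of_forall_right h₂]

section TwoPlayer
variable {A₁ A₂ : Type*} [Fintype A₁] [Fintype A₂] [DecidableEq A₁] [DecidableEq A₂]

theorem totPay_pureBeh_succ (u : A₁ → A₂ → ℝ) (μ₁ : Hist A₁ A₂ → A₁) (μ₂ : Hist A₁ A₂ → A₂)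
    (T : ℕ) (h : Hist A₁ A₂) :
    totPay u (pureBeh1 μ₁) (pureBeh2 μ₂) (T + 1) h =
      u (μ₁ h) (μ₂ h) + totPay u (pureBeh1 μ₁) (pureBeh2 μ₂) T (h ++ [(μ₁ h, μ₂ h)]) := by
  simp [totPay, pureBeh1, pureBeh2, Mix.pure]

theorem totPay_pureBeh_append (u : A₁ → A₂ → ℝ) (μ₁ : Hist A₁ A₂ → A₁)
    (μ₂ : Hist A₁ A₂ → A₂) (h : Hist A₁ A₂) (T : ℕ) (l : Hist A₁ A₂) :
    totPay u (pureBeh1 μ₁) (pureBeh2 μ₂) T (h ++ l) =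
      totPay u (pureBeh1 (condS μ₁ h)) (pureBeh2 (condS μ₂ h)) T l := by
  induction T generalizing l with
  | zero => rfl
  | succ T ih => simp only [totPay_pureBeh_succ, List.append_assoc, ih, condS]

theorem totPay_eq_sum (u : A₁ → A₂ → ℝ) {f : ℕ → A₁ × A₂} {μ₁ : Hist A₁ A₂ → A₁}
    {μ₂ : Hist A₁ A₂ → A₂} (h₁ : ∀ l, μ₁ l = (f l.length).1) (h₂ : ∀ l, μ₂ l = (f l.length).2)
    (T : ℕ) (l : Hist A₁ A₂) :
    totPay u (pureBeh1 μ₁) (pureBeh2 μ₂) T l =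
      ∑ i ∈ range T, u (f (l.length + i)).1 (f (l.length + i)).2 := by
  induction T generalizing l with
  | zero => rfl
  | succ T ih =>
    rw [totPay_pureBeh_succ, ih, sum_range_succ', h₁, h₂, add_comm]
    simp [add_assoc, add_comm 1]

/-- Against an opponent who plays a history-independent sequence of stage equilibria, player 1
cannot earn more than the equilibrium payoffs. -/
theorem totPay_le_sum_left {u₁ u₂ : A₁ → A₂ → ℝ} {f : ℕ → A₁ × A₂}
    (hf : ∀ i, f i ∈ NashPP u₁ u₂) {μ₂ : Hist A₁ A₂ → A₂} (h₂ : ∀ l, μ₂ l = (f l.length).2)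
    (ν₁ : Hist A₁ A₂ → A₁) (T : ℕ) (l : Hist A₁ A₂) :
    totPay u₁ (pureBeh1 ν₁) (pureBeh2 μ₂) T l ≤
      ∑ i ∈ range T, u₁ (f (l.length + i)).1 (f (l.length + i)).2 := by
  induction T generalizing l with
  | zero => exact le_rfl
  | succ T ih =>
    have h := ih (l ++ [(ν₁ l, μ₂ l)])
    have h' := (hf l.length).1 (ν₁ l)
    rw [totPay_pureBeh_succ, sum_range_succ', add_comm]
    refine add_le_add ?_ (by simpa [h₂ l] using h')
    simpa [add_assoc, add_comm 1] using h

/-- Against an opponent who plays a history-independent sequence of stage equilibria, player 2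
cannot earn more than the equilibrium payoffs. -/
theorem totPay_le_sum_right {u₁ u₂ : A₁ → A₂ → ℝ} {f : ℕ → A₁ × A₂}
    (hf : ∀ i, f i ∈ NashPP u₁ u₂) {μ₁ : Hist A₁ A₂ → A₁} (h₁ : ∀ l, μ₁ l = (f l.length).1)
    (ν₂ : Hist A₁ A₂ → A₂) (T : ℕ) (l : Hist A₁ A₂) :
    totPay u₂ (pureBeh1 μ₁) (pureBeh2 ν₂) T l ≤
      ∑ i ∈ range T, u₂ (f (l.length + i)).1 (f (l.length + i)).2 := by
  induction T generalizing l with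
  | zero => exact le_rfl
  | succ T ih =>
    have h := ih (l ++ [(μ₁ l, ν₂ l)])
    have h' := (hf l.length).2 (ν₂ l)
    rw [totPay_pureBeh_succ, sum_range_succ', add_comm]
    refine add_le_add ?_ (by simpa [h₁ l] using h')
    simpa [add_assoc, add_comm 1] using h

/-- The profile that plays `q` in the first round and then, if the first round ended in `c`, the
sequence of profiles `s c`. -/
def openingProfile (q : A₁ × A₂) (s : A₁ × A₂ → ℕ → A₁ × A₂) : Hist A₁ A₂ → A₁ × A₂
  | [] => q
  | c :: l => s c l.length

/-- If every continuation sequence consists of stage equilibria and no unilateral deviation in the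
first round pays off, the opening profile is subgame perfect. -/
theorem isSPEpp_openingProfile {u₁ u₂ : A₁ → A₂ → ℝ} {q : A₁ × A₂}
    {s : A₁ × A₂ → ℕ → A₁ × A₂} (hs : ∀ c i, s c i ∈ NashPP u₁ u₂) (T : ℕ)
    (h₁ : ∀ a, u₁ a q.2 + ∑ i ∈ range T, u₁ (s (a, q.2) i).1 (s (a, q.2) i).2 ≤
      u₁ q.1 q.2 + ∑ i ∈ range T, u₁ (s q i).1 (s q i).2)
    (h₂ : ∀ b, u₂ q.1 b + ∑ i ∈ range T, u₂ (s (q.1, b) i).1 (s (q.1, b) i).2 ≤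
      u₂ q.1 q.2 + ∑ i ∈ range T, u₂ (s q i).1 (s q i).2) :
    isSPEpp u₁ u₂ (T + 1) (fun h => (openingProfile q s h).1)
      (fun h => (openingProfile q s h).2) := by
  rintro (_ | ⟨c, t⟩) -
  · have e₁ : ∀ c l, condS (fun h => (openingProfile q s h).1) [c] l = (s c l.length).1 :=
      fun _ _ => rfl
    have e₂ : ∀ c l, condS (fun h => (openingProfile q s h).2) [c] l = (s c l.length).2 :=
      fun _ _ => rfl
    have key : ∀ u : A₁ → A₂ → ℝ,
        totPay u (pureBeh1 fun h => (openingProfile q s h).1)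
          (pureBeh2 fun h => (openingProfile q s h).2) (T + 1) [] =
        u q.1 q.2 + ∑ i ∈ range T, u (s q i).1 (s q i).2 := by
      intro u
      rw [totPay_pureBeh_succ, List.nil_append, ← List.append_nil [_], totPay_pureBeh_append,
        totPay_eq_sum u (e₁ _) (e₂ _)]
      simp [openingProfile]
    constructor
    · intro ν
      refine le_trans ?_ ((h₁ (ν [])).trans (key u₁).ge)
      change totPay u₁ (pureBeh1 ν) (pureBeh2 fun h => (openingProfile q s h).2) (T + 1) [] ≤ _
      rw [totPay_pureBeh_succ, List.nil_append, ← List.append_nil [_], totPay_pureBeh_append]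
      have h := totPay_le_sum_left (hs (ν [], q.2)) (e₂ _) (condS ν [(ν [], q.2)]) T []
      simpa [openingProfile] using h
    · intro ν
      refine le_trans ?_ ((h₂ (ν [])).trans (key u₂).ge)
      change totPay u₂ (pureBeh1 fun h => (openingProfile q s h).1) (pureBeh2 ν) (T + 1) [] ≤ _
      rw [totPay_pureBeh_succ, List.nil_append, ← List.append_nil [_], totPay_pureBeh_append]
      have h := totPay_le_sum_right (hs (q.1, ν [])) (e₁ _) (condS ν [(q.1, ν [])]) T []
      simpa [openingProfile] using h
  · have e₁ : ∀ l, condS (fun h => (openingProfile q s h).1) (c :: t) l =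
        (s c (t.length + l.length)).1 := fun l => by simp [condS, openingProfile]
    have e₂ : ∀ l, condS (fun h => (openingProfile q s h).2) (c :: t) l =
        (s c (t.length + l.length)).2 := fun l => by simp [condS, openingProfile]
    have hf : ∀ i, s c (t.length + i) ∈ NashPP u₁ u₂ := fun i => hs _ _
    constructor
    · intro ν
      rw [totPay_eq_sum u₁ (f := fun i => s c (t.length + i)) e₁ e₂]
      exact totPay_le_sum_left hf e₂ ν _ _
    · intro ν
      rw [totPay_eq_sum u₂ (f := fun i => s c (t.length + i)) e₁ e₂]
      exact totPay_le_sum_right hf e₁ ν _ _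

theorem sum_range_ite_lt {α : Type*} (v : α → ℝ) (x y : α) (n : ℕ) :
    ∑ i ∈ range (n + n), v (if i < n then x else y) = n * v x + n * v y := by
  rw [sum_range_add]
  congr 1
  · rw [sum_congr rfl (g := fun _ => v x) fun i hi => by rw [if_pos (mem_range.1 hi)]]
    simp
  · simp

theorem exists_nat_forall_le_mul {α : Type*} [Finite α] (f : α → ℝ) {δ : ℝ} (hδ : 0 < δ) :
    ∃ N : ℕ, ∀ n ≥ N, ∀ a, f a ≤ n * δ := by
  obtain ⟨M, hM⟩ := (Set.finite_range f).bddAbove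
  obtain ⟨N, hN⟩ := exists_nat_ge (M / δ)
  refine ⟨N, fun n hn a => (hM ⟨a, rfl⟩).trans ?_⟩
  rw [← div_le_iff₀ hδ]
  exact hN.trans (by exact_mod_cast hn)

/-- If both players have at least two pure equilibrium payoffs, any pure profile that is not an
equilibrium can be played in the first round of a pure subgame-perfect equilibrium. -/
theorem GLSpp_of_notMem_NashPP {u₁ u₂ : A₁ → A₂ → ℝ} (hV1 : (V1pp u₁ u₂).Nontrivial)
    (hV2 : (V2pp u₁ u₂).Nontrivial) {q : A₁ × A₂} (hq : q ∉ NashPP u₁ u₂) : GLSpp u₁ u₂ := by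
  obtain ⟨_, ⟨b₁, hb₁, rfl⟩, _, ⟨g₁, hg₁, rfl⟩, hlt₁⟩ := hV1.exists_lt
  obtain ⟨_, ⟨b₂, hb₂, rfl⟩, _, ⟨g₂, hg₂, rfl⟩, hlt₂⟩ := hV2.exists_lt
  obtain ⟨N₁, hN₁⟩ := exists_nat_forall_le_mul (fun a => u₁ a q.2 - u₁ q.1 q.2)
    (sub_pos.2 hlt₁)
  obtain ⟨N₂, hN₂⟩ := exists_nat_forall_le_mul (fun b => u₂ q.1 b - u₂ q.1 q.2)
    (sub_pos.2 hlt₂)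
  set n := max N₁ N₂
  have hn₁ := hN₁ n (le_max_left _ _)
  have hn₂ := hN₂ n (le_max_right _ _)
  let s : A₁ × A₂ → ℕ → A₁ × A₂ := fun c i =>
    if i < n then (if c.1 = q.1 then g₁ else b₁) else (if c.2 = q.2 then g₂ else b₂)
  have hs : ∀ c i, s c i ∈ NashPP u₁ u₂ := by
    intro c i
    dsimp only [s]
    split_ifs <;> assumption
  have hsum : ∀ (u : A₁ → A₂ → ℝ) (c : A₁ × A₂),
      ∑ i ∈ range (n + n), u (s c i).1 (s c i).2 =
        n * (fun r : A₁ × A₂ => u r.1 r.2) (if c.1 = q.1 then g₁ else b₁) +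
        n * (fun r : A₁ × A₂ => u r.1 r.2) (if c.2 = q.2 then g₂ else b₂) :=
    fun u c => sum_range_ite_lt (fun r : A₁ × A₂ => u r.1 r.2) _ _ n
  refine ⟨n + n + 1, by omega, _, _, isSPEpp_openingProfile (q := q) hs (n + n) ?_ ?_,
    [], by simp, hq⟩
  · intro a
    rw [hsum, hsum]
    by_cases ha : a = q.1
    · simp [ha]
    · have h := hn₁ a
      simp only [ha, if_true, if_false]
      linarith
  · intro b
    rw [hsum, hsum]
    by_cases hb : b = q.2
    · simp [hb]
    · have h := hn₂ b
      simp only [hb, if_true, if_false]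
      linarith

end TwoPlayer

section TwoPlayer
variable {A₁ A₂ : Type*} [Fintype A₁] [Fintype A₂] [DecidableEq A₁] [DecidableEq A₂]
variable [Nonempty A₁] [Nonempty A₂]

/-- If `|V₁^{p,p}| > 1`, `|V₂^{p,p}| > 1`, and `G ∈ 𝒢_LS^{m,m}`, then `G ∈ 𝒢_LS^{p,p}`. -/
theorem GLSpp_of_GLSmm (u₁ u₂ : A₁ → A₂ → ℝ)
    (hV1 : (V1pp u₁ u₂).Nontrivial) (hV2 : (V2pp u₁ u₂).Nontrivial)
    (h : GLSmm u₁ u₂) : GLSpp u₁ u₂ := by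
  obtain ⟨_, -, _, _, -, _, -, hmm⟩ := h
  by_contra hpp
  exact hmm (mem_NashMM_of_forall_mem_NashPP
    (fun q => by_contra fun hq => hpp (GLSpp_of_notMem_NashPP hV1 hV2 hq)) _)

end TwoPlayer
end
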